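/- arXiv:2403.14761 — 10 statements merged into one kernel-verified Lean document; each statement's English description precedes it below -/
import Mathlib

section
/- Let d ≥ 1 and let Q be a set of m points in ℝ^d such that the convex hull conv(Q) contains the closed Euclidean unit ball B^d. Then there exists a subset Q' ⊆ Q of at most 2d points such that conv(Q') contains the ball r·B^d, where r = 1/(2(m+d)+1). -/
open Metric

/-- A conic version of Carathéodory's theorem that does not increase the total weight. -/
theorem exists_conic_combination_card_le_finrank {ι V : Type*} [DecidableEq ι] [AddCommGroup V]
    [Module ℝ V] [FiniteDimensional ℝ V] (w : ι → V) (s : Finset ι) (c : ι → ℝ)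
    (hc : ∀ i ∈ s, 0 ≤ c i) :
    ∃ t ⊆ s, ∃ c' : ι → ℝ, t.card ≤ Module.finrank ℝ V ∧ (∀ i ∈ t, 0 ≤ c' i) ∧
      ∑ i ∈ t, c' i • w i = ∑ i ∈ s, c i • w i ∧ ∑ i ∈ t, c' i ≤ ∑ i ∈ s, c i := by
  induction s using Finset.strongInduction generalizing c with
  | H s ih =>
  by_cases hs : LinearIndepOn ℝ w (s : Set ι)
  · refine ⟨s, subset_rfl, c, ?_, hc, rfl, le_rfl⟩
    simpa using LinearIndependent.fintype_card_le_finrank (show LinearIndependent ℝ _ from hs)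
  obtain ⟨g, hgw, hgs, i₀, hi₀, hg₀⟩ : ∃ g : ι → ℝ, ∑ i ∈ s, g i • w i = 0 ∧
      0 ≤ ∑ i ∈ s, g i ∧ ∃ i ∈ s, g i ≠ 0 := by
    obtain ⟨g, hgw, i, hi, hg⟩ := not_linearIndepOn_finset_iff.1 hs
    rcases le_total 0 (∑ i ∈ s, g i) with h | h
    · exact ⟨g, hgw, h, i, hi, hg⟩
    · exact ⟨-g, by simp [hgw], by simpa using h, i, hi, by simpa using hg⟩
  have hpos : (s.filter fun i => 0 < g i).Nonempty := by
    by_contra! h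
    have hle : ∀ i ∈ s, g i ≤ 0 := by simpa [Finset.filter_eq_empty_iff] using h
    exact hg₀ ((Finset.sum_eq_zero_iff_of_nonpos hle).1
      (le_antisymm (Finset.sum_nonpos hle) hgs) i₀ hi₀)
  obtain ⟨k, hk, hmin⟩ := Finset.exists_min_image _ (fun i => c i / g i) hpos
  obtain ⟨hks, hgk⟩ := Finset.mem_filter.1 hk
  set r := c k / g k with hr
  have hr0 : 0 ≤ r := div_nonneg (hc k hks) hgk.le
  have hk0 : c k - r * g k = 0 := by rw [hr]; field_simp; ring
  obtain ⟨t, hts, c', hcard, hc', hsum, hle⟩ := ih (s.erase k) (Finset.erase_ssubset hks)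
    (fun i => c i - r * g i) (by
      intro i hi
      have his := Finset.mem_of_mem_erase hi
      rcases lt_or_ge 0 (g i) with h | h
      · have := hmin i (Finset.mem_filter.2 ⟨his, h⟩)
        rw [le_div_iff₀ h] at this
        linarith
      · nlinarith [hc i his, mul_nonneg hr0 (neg_nonneg.2 h)])
  refine ⟨t, hts.trans (Finset.erase_subset _ _), c', hcard, hc', hsum.trans ?_, hle.trans ?_⟩
  · rw [Finset.sum_erase _ (by simp [hk0])]
    simp [sub_smul, mul_smul, Finset.sum_sub_distrib, ← Finset.smul_sum, hgw]
  · rw [Finset.sum_erase s (f := fun i => c i - r * g i) hk0, Finset.sum_sub_distrib, ← Finset.mul_sum]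
    nlinarith [mul_nonneg hr0 hgs]

/-- A finite spanning family contains a basis in which all its members have coordinates
in `[-1, 1]`. -/
theorem exists_basis_abs_coord_le_one {ι V : Type*} [AddCommGroup V]
    [Module ℝ V] [FiniteDimensional ℝ V] (w : ι → V) (s : Finset ι)
    (hs : Submodule.span ℝ (w '' (s : Set ι)) = ⊤) :
    ∃ σ : Fin (Module.finrank ℝ V) → ι, (∀ j, σ j ∈ s) ∧ Function.Injective σ ∧
      ∀ i ∈ s, ∃ β : Fin (Module.finrank ℝ V) → ℝ, (∀ j, |β j| ≤ 1) ∧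
        w i = ∑ j, β j • w (σ j) := by
  classical
  let e := Module.finBasis ℝ V
  let F : Finset (Fin (Module.finrank ℝ V) → ι) := Fintype.piFinset fun _ => s
  obtain ⟨τ, hτF, hτ⟩ : ∃ τ ∈ F, e.det (w ∘ τ) ≠ 0 := by
    obtain ⟨f, hfs, hspan, hli⟩ := Submodule.exists_fun_fin_finrank_span_eq ℝ (w '' (s : Set ι))
    have hrank : Module.finrank ℝ (Submodule.span ℝ (w '' (s : Set ι))) = Module.finrank ℝ V := by
      rw [hs, finrank_top]
    choose τ hτs hτ using hfs
    refine ⟨τ ∘ finCongr hrank.symm, by simpa [F] using fun j => hτs _, ?_⟩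
    have hf : w ∘ τ ∘ finCongr hrank.symm = f ∘ finCongr hrank.symm := by
      ext j; simp [hτ]
    rw [hf]
    refine ((Module.Basis.is_basis_iff_det e).1
      ⟨hli.comp _ ((finCongr hrank.symm).injective), ?_⟩).ne_zero
    rw [Function.Surjective.range_comp (finCongr hrank.symm).surjective f, hspan, hs]
  obtain ⟨σ, hσF, hmax⟩ := Finset.exists_max_image F (fun σ => |e.det (w ∘ σ)|) ⟨τ, hτF⟩
  have hσ : 0 < |e.det (w ∘ σ)| := (abs_pos.2 hτ).trans_le (hmax τ hτF)
  have hσs : ∀ j, σ j ∈ s := by simpa [F] using hσF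
  obtain ⟨hli, hsp⟩ := (Module.Basis.is_basis_iff_det e).2 (abs_pos.1 hσ).isUnit
  refine ⟨σ, hσs, hli.injective.of_comp, fun i hi =>
    ⟨fun j => (Module.Basis.mk hli hsp.ge).repr (w i) j, fun j => ?_, ?_⟩⟩
  · have h := LinearMap.congr_fun (e.det_smul_mk_coord_eq_det_update hli hsp.ge j) (w i)
    have hup : Function.update (w ∘ σ) j (w i) = w ∘ Function.update σ j i := by
      rw [Function.comp_update]
    simp only [LinearMap.smul_apply, smul_eq_mul, Module.Basis.coord_apply,
      MultilinearMap.toLinearMap_apply, AlternatingMap.coe_multilinearMap, hup] at h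
    have hm := hmax (Function.update σ j i) (by
      simp only [F, Fintype.mem_piFinset]
      intro l
      rcases eq_or_ne l j with rfl | hl
      · simpa using hi
      · simpa [hl] using hσs l)
    rw [← h, abs_mul] at hm
    exact le_of_mul_le_mul_left (by simpa using hm) hσ
  · simpa using ((Module.Basis.mk hli hsp.ge).sum_repr (w i)).symm

section InnerProductSpace

variable {E : Type*} [NormedAddCommGroup E] [InnerProductSpace ℝ E]

/-- The analytic center `c` of a bounded polyhedron `{x | ∀ q ∈ Q, ⟪q, x⟫ ≤ 1}`: the vertices
of the polar of the polyhedron translated by `-c` sum to zero. -/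
theorem exists_analytic_center [FiniteDimensional ℝ E] (Q : Finset E) (R : ℝ)
    (hR : ∀ x : E, (∀ q ∈ Q, inner ℝ q x ≤ 1) → ‖x‖ ≤ R) :
    ∃ c : E, (∀ q ∈ Q, inner ℝ q c < 1) ∧ ∑ q ∈ Q, (1 - inner ℝ q c)⁻¹ • q = 0 := by
  classical
  let P : Set E := {x | ∀ q ∈ Q, inner ℝ q x ≤ 1}
  have hPc : IsClosed P := by
    simp only [P, Set.ofPred_forall]
    exact isClosed_biInter fun q _ => isClosed_le (by fun_prop) continuous_const
  have hP : IsCompact P := (isCompact_closedBall (0 : E) R).of_isClosed_subset hPc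
    fun x hx => by simpa using hR x hx
  obtain ⟨c, hcP, hmax⟩ := hP.exists_isMaxOn ⟨0, fun q _ => by simp⟩
    (f := fun x => ∏ q ∈ Q, (1 - inner ℝ q x)) (by fun_prop)
  have hprod : 0 < ∏ q ∈ Q, (1 - inner ℝ q c) := by
    have := hmax (show (0 : E) ∈ P from fun q _ => by simp)
    simp only [inner_zero_right, sub_zero, Finset.prod_const_one, Set.mem_ofPred_eq] at this
    linarith
  have hc : ∀ q ∈ Q, inner ℝ q c < 1 := fun q hq =>
    lt_of_le_of_ne (hcP q hq) fun h =>
      hprod.ne' (Finset.prod_eq_zero hq (by rw [h, sub_self]))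
  refine ⟨c, hc, ext_inner_right ℝ fun h => ?_⟩
  have hmem : ∀ᶠ t : ℝ in nhds 0, c + t • h ∈ P := by
    have : ∀ q ∈ Q, ∀ᶠ t : ℝ in nhds 0, inner ℝ q (c + t • h) < 1 := fun q hq =>
      ContinuousAt.eventually_lt (f := fun t : ℝ => inner ℝ q (c + t • h)) (by fun_prop)
        continuousAt_const (by simpa using hc q hq)
    filter_upwards [(Q.eventually_all).2 this] with t ht q hq using (ht q hq).le
  have hloc : IsLocalMax (fun t : ℝ => ∏ q ∈ Q, (1 - inner ℝ q (c + t • h))) 0 := by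
    filter_upwards [hmem] with t ht
    simpa using hmax ht
  have hderiv : ∀ q ∈ Q, HasDerivAt (fun t : ℝ => 1 - inner ℝ q (c + t • h))
      (-inner ℝ q h) 0 := fun q _ => by
    have := ((hasDerivAt_id (0 : ℝ)).mul_const (inner ℝ q h)).const_sub (1 - inner ℝ q c)
    simp only [one_mul] at this
    refine this.congr_of_eventuallyEq (Filter.Eventually.of_forall fun t => ?_)
    simp only [inner_add_right, inner_smul_right, id]
    ring
  have hzero := hloc.hasDerivAt_eq_zero (HasDerivAt.fun_finsetProd hderiv)
  have herase : ∀ q ∈ Q, ∏ p ∈ Q.erase q, (1 - inner ℝ p (c + (0 : ℝ) • h)) =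
      (∏ p ∈ Q, (1 - inner ℝ p c)) * (1 - inner ℝ q c)⁻¹ := fun q hq => by
    rw [← Finset.mul_prod_erase Q _ hq]
    have := (sub_pos.2 (hc q hq)).ne'
    simp only [zero_smul, add_zero]
    field_simp
  rw [Finset.sum_congr rfl fun q hq => by rw [herase q hq]] at hzero
  simp only [smul_eq_mul, mul_neg, Finset.sum_neg_distrib, neg_eq_zero, mul_assoc,
    ← Finset.mul_sum, mul_eq_zero, hprod.ne', false_or] at hzero
  simpa [sum_inner, real_inner_smul_left] using hzero

theorem norm_le_one_of_inner_le_one {s : Set E} (hs : closedBall (0 : E) 1 ⊆ convexHull ℝ s)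
    {x : E} (hx : ∀ q ∈ s, inner ℝ q x ≤ 1) : ‖x‖ ≤ 1 := by
  rcases eq_or_ne x 0 with rfl | hx0
  · simp
  have hconv : Convex ℝ {y : E | inner ℝ y x ≤ 1} := by
    simpa [real_inner_comm] using convex_halfSpace_le (innerₗ E x).isLinear 1
  have hmem : ‖x‖⁻¹ • x ∈ convexHull ℝ s := hs (by
    simp [norm_smul, inv_mul_cancel₀ (norm_ne_zero_iff.2 hx0)])
  have h : inner ℝ (‖x‖⁻¹ • x) x ≤ 1 :=
    convexHull_min (t := {y : E | inner ℝ y x ≤ 1}) hx hconv hmem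
  have hpos := norm_pos_iff.2 hx0
  simp only [real_inner_smul_left, real_inner_self_eq_norm_sq] at h
  field_simp at h
  exact h

theorem closedBall_subset_convexHull_of_polar_bounded [FiniteDimensional ℝ E] (Q : Finset E)
    (hne : Q.Nonempty) {R : ℝ} (hR : 0 < R)
    (hQ : ∀ x : E, (∀ q ∈ Q, inner ℝ q x ≤ 1) → ‖x‖ ≤ R) :
    closedBall (0 : E) (1 / R) ⊆ convexHull ℝ (Q : Set E) := by
  intro z hz
  by_contra hzQ
  obtain ⟨f, u, hfu, huz⟩ := geometric_hahn_banach_closed_point (convex_convexHull ℝ (Q : Set E))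
    (Q.finite_toSet.isClosed_convexHull ℝ) hzQ
  obtain ⟨x, rfl⟩ := (InnerProductSpace.toDual ℝ E).surjective f
  simp only [InnerProductSpace.toDual_apply_apply] at hfu huz
  replace hfu : ∀ q ∈ Q, inner ℝ q x < u := fun q hq => by
    rw [real_inner_comm]; exact hfu q (subset_convexHull ℝ _ hq)
  rcases lt_or_ge 0 u with hu | hu
  · have hx := hQ (u⁻¹ • x) fun q hq => by
      rw [inner_smul_right, inv_mul_le_iff₀ hu, mul_one]
      exact (hfu q hq).le
    rw [norm_smul, norm_inv, Real.norm_of_nonneg hu.le, inv_mul_le_iff₀ hu] at hx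
    have hz' : ‖z‖ ≤ 1 / R := by simpa using hz
    have : ‖x‖ * ‖z‖ ≤ u * R * (1 / R) := by gcongr
    have h2 : u * R * (1 / R) = u := by field_simp
    linarith [real_inner_le_norm x z]
  · obtain ⟨q, hq⟩ := hne
    have hx0 : 0 < ‖x‖ := norm_pos_iff.2 fun h => by
      have := hfu q hq
      simp only [h, inner_zero_right] at this
      linarith
    have hx := hQ (((R + 1) / ‖x‖) • x) fun p hp => by
      rw [inner_smul_right]
      have : (R + 1) / ‖x‖ * inner ℝ p x ≤ 0 :=
        mul_nonpos_of_nonneg_of_nonpos (by positivity) ((hfu p hp).le.trans hu)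
      linarith
    rw [norm_smul, Real.norm_of_nonneg (by positivity), div_mul_cancel₀ _ hx0.ne'] at hx
    linarith

theorem span_eq_top_of_polar_bounded [FiniteDimensional ℝ E] (s : Set E) (R : ℝ)
    (hR : ∀ x : E, (∀ q ∈ s, inner ℝ q x ≤ 1) → ‖x‖ ≤ R) : Submodule.span ℝ s = ⊤ := by
  rw [← Submodule.orthogonal_eq_bot_iff, Submodule.eq_bot_iff]
  intro x hx
  by_contra hx0
  have hpos := norm_pos_iff.2 hx0
  have h := hR (((|R| + 1) / ‖x‖) • x) fun q hq => by
    rw [inner_smul_right, (Submodule.mem_orthogonal _ _).1 hx q (Submodule.subset_span hq)]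
    simp
  rw [norm_smul, Real.norm_of_nonneg (by positivity), div_mul_cancel₀ _ hpos.ne'] at h
  linarith [le_abs_self R]

/-- A finite family with zero sum and spanning a `d`-dimensional space contains `2 * d` members
whose polar is contained in the polar of the whole family, scaled by its cardinality plus `d`. -/
theorem exists_subfamily_inner_le {ι : Type*} [DecidableEq ι] [FiniteDimensional ℝ E]
    (w : ι → E) (s : Finset ι) (hs : Submodule.span ℝ (w '' (s : Set ι)) = ⊤)
    (hsum : ∑ i ∈ s, w i = 0) :
    ∃ t ⊆ s, Module.finrank ℝ E ≤ t.card ∧ t.card ≤ 2 * Module.finrank ℝ E ∧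
      ∀ y : E, (∀ i ∈ t, inner ℝ (w i) y ≤ 1) →
        ∀ i ∈ s, inner ℝ (w i) y ≤ s.card + Module.finrank ℝ E := by
  obtain ⟨σ, hσs, hσ, hβ⟩ := exists_basis_abs_coord_le_one w s hs
  set V := Finset.univ.image σ with hV
  have hVs : V ⊆ s := by simpa [hV, Finset.image_subset_iff] using hσs
  have hVcard : V.card = Module.finrank ℝ E := by simp [hV, Finset.card_image_of_injective _ hσ]
  obtain ⟨t, hts, c, htcard, hc, hcw, hcsum⟩ :=
    exists_conic_combination_card_le_finrank w (s \ V) (fun _ => 1) (by simp)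
  refine ⟨V ∪ t, Finset.union_subset hVs (hts.trans Finset.sdiff_subset),
    hVcard ▸ Finset.card_le_card Finset.subset_union_left,
    (Finset.card_union_le _ _).trans (by omega), fun y hy i hi => ?_⟩
  obtain ⟨β, hβ1, hwi⟩ := hβ i hi
  have hneg : -∑ j, inner ℝ (w (σ j)) y ≤ s.card - Module.finrank ℝ E := by
    have h1 : -∑ j, w (σ j) = ∑ i ∈ t, c i • w i := by
      have := Finset.sum_sdiff hVs (f := w)
      rw [hsum, hV, Finset.sum_image hσ.injOn] at this
      rw [hcw, eq_comm, eq_neg_iff_add_eq_zero]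
      simpa [hV] using this
    have hcard : ((s \ V).card : ℝ) = s.card - Module.finrank ℝ E := by
      rw [Finset.card_sdiff_of_subset hVs, Nat.cast_sub (Finset.card_le_card hVs), hVcard]
    calc -∑ j, inner ℝ (w (σ j)) y = inner ℝ (-∑ j, w (σ j)) y := by
          rw [inner_neg_left, sum_inner]
      _ = ∑ i ∈ t, c i * inner ℝ (w i) y := by
          rw [h1, sum_inner]; simp [real_inner_smul_left]
      _ ≤ ∑ i ∈ t, c i := Finset.sum_le_sum fun i hi =>
          mul_le_of_le_one_right (hc i hi) (hy i (Finset.mem_union_right _ hi))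
      _ ≤ s.card - Module.finrank ℝ E := by
          rw [← hcard]; simpa using hcsum
  calc inner ℝ (w i) y = ∑ j, β j * inner ℝ (w (σ j)) y := by
        rw [hwi, sum_inner]; simp [real_inner_smul_left]
    _ ≤ ∑ j, (2 - inner ℝ (w (σ j)) y) := Finset.sum_le_sum fun j _ => by
        have h1 : inner ℝ (w (σ j)) y ≤ 1 :=
          hy _ (Finset.mem_union_left _ (Finset.mem_image_of_mem σ (Finset.mem_univ j)))
        obtain ⟨hl, hu⟩ := abs_le.1 (hβ1 j)
        nlinarith [mul_nonneg (sub_nonneg.2 h1) (by linarith : (0 : ℝ) ≤ 1 + β j)]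
    _ ≤ s.card + Module.finrank ℝ E := by
        rw [Finset.sum_sub_distrib]
        simp only [Finset.sum_const, Finset.card_univ, Fintype.card_fin, nsmul_eq_mul]
        linarith

end InnerProductSpace

/-- **Quantitative Steinitz theorem with dropped points.**
If `Q` is a set of `m` points in `ℝ^d` whose convex hull contains the closed
Euclidean unit ball, then there is a subset `Q' ⊆ Q` of at most `2d` points whose
convex hull contains the ball of radius `1 / (2(m+d) + 1)` centered at the origin. -/
theorem steinitz_dropping_out_points (d m : ℕ) (hd : 1 ≤ d)
    (Q : Finset (EuclideanSpace ℝ (Fin d))) (hm : Q.card = m)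
    (hQ : closedBall (0 : EuclideanSpace ℝ (Fin d)) 1 ⊆ convexHull ℝ (Q : Set (EuclideanSpace ℝ (Fin d)))) :
    ∃ Q' ⊆ Q, Q'.card ≤ 2 * d ∧
      closedBall (0 : EuclideanSpace ℝ (Fin d)) (1 / (2 * ((m : ℝ) + d) + 1)) ⊆
        convexHull ℝ (Q' : Set (EuclideanSpace ℝ (Fin d))) := by
  classical
  subst hm
  have hP : ∀ x : EuclideanSpace ℝ (Fin d), (∀ q ∈ Q, inner ℝ q x ≤ 1) → ‖x‖ ≤ 1 :=
    fun x hx => norm_le_one_of_inner_le_one hQ hx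
  obtain ⟨c, hc, hsum⟩ := exists_analytic_center Q 1 hP
  have hc1 : ‖c‖ ≤ 1 := hP c fun q hq => (hc q hq).le
  have hiff : ∀ q ∈ Q, ∀ (y : EuclideanSpace ℝ (Fin d)) (a : ℝ),
      inner ℝ ((1 - inner ℝ q c)⁻¹ • q) y ≤ a ↔ inner ℝ q y ≤ a * (1 - inner ℝ q c) :=
    fun q hq y a => by
      rw [real_inner_smul_left, inv_mul_le_iff₀ (sub_pos.2 (hc q hq)), mul_comm a]
  have hshrink : ∀ (k : ℝ), 0 < k → ∀ y : EuclideanSpace ℝ (Fin d),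
      (∀ q ∈ Q, inner ℝ ((1 - inner ℝ q c)⁻¹ • q) y ≤ k) → ‖y‖ ≤ 2 * k := by
    intro k hk y hy
    have h := hP (c + k⁻¹ • y) fun q hq => by
      have := (hiff q hq y k).1 (hy q hq)
      rw [← inv_mul_le_iff₀ hk] at this
      rw [inner_add_right, inner_smul_right]
      linarith
    have h2 : ‖k⁻¹ • y‖ ≤ 2 := by
      calc ‖k⁻¹ • y‖ = ‖(c + k⁻¹ • y) - c‖ := by simp
        _ ≤ 2 := (norm_sub_le _ _).trans (by linarith)
    rw [norm_smul, norm_inv, Real.norm_of_nonneg hk.le, inv_mul_le_iff₀ hk] at h2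
    linarith
  obtain ⟨t, htQ, htd, htcard, ht⟩ := exists_subfamily_inner_le
    (fun q => (1 - inner ℝ q c)⁻¹ • q) Q
    (span_eq_top_of_polar_bounded _ (2 * 1) fun y hy =>
      hshrink 1 one_pos y fun q hq => hy _ (Set.mem_image_of_mem _ hq)) hsum
  simp only [finrank_euclideanSpace, Fintype.card_fin] at htd htcard ht
  refine ⟨t, htQ, htcard, closedBall_subset_convexHull_of_polar_bounded t
    (Finset.card_pos.1 (by omega)) (by positivity) fun x hx => ?_⟩
  have hk : (0 : ℝ) < Q.card + d := by
    have : (1 : ℝ) ≤ d := by exact_mod_cast hd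
    positivity
  have h := hshrink _ hk (x - c) (ht (x - c) fun q hq => by
    rw [hiff q (htQ hq), inner_sub_right]
    linarith [hx q hq])
  calc ‖x‖ = ‖(x - c) + c‖ := by simp
    _ ≤ 2 * ((Q.card : ℝ) + d) + 1 := (norm_add_le _ _).trans (by linarith)
end

section
/- Let d ≥ 1, let α > 1 be such that α·d is a positive integer, and let Q be a set of α·d points in ℝ^d such that conv(Q) contains the ball λ·B^d for some λ > 0. Then there exists a subset Q' ⊆ Q of at most 2d points such that conv(Q') contains the ball (λ/(5αd))·B^d. -/
open Metric

/-- Conic Carathéodory theorem: a nonnegative combination can be supported on a linearly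
independent subfamily, without increasing the sum of the coefficients. -/
theorem exists_linearIndepOn_nonneg_combination {ι V : Type*} [AddCommGroup V] [Module ℝ V]
    (p : ι → V) (s : Finset ι) (w : ι → ℝ) (hw : ∀ i ∈ s, 0 ≤ w i) :
    ∃ t ⊆ s, ∃ w' : ι → ℝ, (∀ i ∈ t, 0 ≤ w' i) ∧ ∑ i ∈ t, w' i • p i = ∑ i ∈ s, w i • p i ∧
      ∑ i ∈ t, w' i ≤ ∑ i ∈ s, w i ∧ LinearIndepOn ℝ p (t : Set ι) := by
  classical
  induction s using Finset.strongInduction generalizing w with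
  | H s ih =>
    by_cases hli : LinearIndepOn ℝ p (s : Set ι)
    · exact ⟨s, subset_rfl, w, hw, rfl, le_rfl, hli⟩
    obtain ⟨g, hg0, hgsum, i₀, hi₀, hgi₀⟩ : ∃ g : ι → ℝ, ∑ i ∈ s, g i • p i = 0 ∧
        0 ≤ ∑ i ∈ s, g i ∧ ∃ i ∈ s, 0 < g i := by
      obtain ⟨g, hg, i, hi, hgi⟩ := not_linearIndepOn_finset_iff.1 hli
      rcases lt_trichotomy (∑ i ∈ s, g i) 0 with h | h | h
      · refine ⟨fun i => -g i, by simp [hg], by simpa using h.le, ?_⟩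
        obtain ⟨j, hj, hj'⟩ := Finset.exists_lt_of_sum_lt (f := g) (g := 0) (by simpa using h)
        exact ⟨j, hj, by simpa using hj'⟩
      · exact ⟨g, hg, h.ge, Finset.exists_pos_of_sum_zero_of_exists_nonzero g h ⟨i, hi, hgi⟩⟩
      · obtain ⟨j, hj, hj'⟩ := Finset.exists_lt_of_sum_lt (f := 0) (g := g) (by simpa using h)
        exact ⟨g, hg, h.le, j, hj, by simpa using hj'⟩
    obtain ⟨k, hk, hkmin⟩ := Finset.exists_min_image (s.filter fun i => 0 < g i)
      (fun i => w i / g i) ⟨i₀, by simp [hi₀, hgi₀]⟩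
    simp only [Finset.mem_filter] at hk hkmin
    obtain ⟨hks, hgk⟩ := hk
    have hr : 0 ≤ w k / g k := div_nonneg (hw k hks) hgk.le
    have hk0 : w k - w k / g k * g k = 0 := by field_simp; ring
    obtain ⟨t, hts, w', hw', hsum, hle, ht⟩ := ih (s.erase k) (Finset.erase_ssubset hks)
      (fun i => w i - w k / g k * g i) (by
        intro i hi
        have his := Finset.mem_of_mem_erase hi
        rcases le_or_gt (g i) 0 with h | h
        · have := hw i his
          have := mul_nonneg hr (neg_nonneg.2 h)
          linarith
        · have := hkmin i ⟨his, h⟩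
          rw [le_div_iff₀ h] at this
          linarith)
    refine ⟨t, hts.trans (Finset.erase_subset _ _), w', hw', ?_, ?_, ht⟩
    · rw [hsum, Finset.sum_erase _ (by simp only [hk0, zero_smul])]
      simp only [sub_smul, mul_smul, Finset.sum_sub_distrib, ← Finset.smul_sum, hg0, smul_zero,
        sub_zero]
    · rw [Finset.sum_erase _ (by simp only [hk0]), Finset.sum_sub_distrib, ← Finset.mul_sum] at hle
      have := mul_nonneg hr hgsum
      linarith

/-- A finite spanning family contains a basis in which all its members have coordinates in
`[-1, 1]`. -/
theorem exists_basis_abs_repr_le_one {ι V : Type*} [Finite ι] [AddCommGroup V] [Module ℝ V]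
    [FiniteDimensional ℝ V] (p : ι → V) (hp : Submodule.span ℝ (Set.range p) = ⊤) :
    ∃ (v : Fin (Module.finrank ℝ V) → ι) (b : Module.Basis (Fin (Module.finrank ℝ V)) ℝ V),
      (∀ j, b j = p (v j)) ∧ ∀ i j, |b.repr (p i) j| ≤ 1 := by
  classical
  obtain ⟨κ, a, -, hspan, hli⟩ := exists_linearIndependent' ℝ p
  rw [hp] at hspan
  let b₀ := Module.Basis.mk hli hspan.ge
  have : Finite κ := Module.Finite.finite_basis b₀
  have : Fintype κ := Fintype.ofFinite κ
  let e : κ ≃ Fin (Module.finrank ℝ V) :=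
    Fintype.equivFinOfCardEq (Module.finrank_eq_card_basis b₀).symm
  let b₁ := b₀.reindex e
  have : Nonempty (Fin (Module.finrank ℝ V) → ι) := ⟨a ∘ e.symm⟩
  obtain ⟨v, hv⟩ := Finite.exists_max fun v : Fin (Module.finrank ℝ V) → ι => |b₁.det (p ∘ v)|
  have hb₁ : ⇑b₁ = p ∘ (a ∘ e.symm) := by
    ext j
    simp [b₁, b₀]
  have hpos : 0 < |b₁.det (p ∘ v)| := by
    have := hv (a ∘ e.symm)
    rw [← hb₁, b₁.det_self, abs_one] at this
    linarith
  obtain ⟨hvli, hvsp⟩ := b₁.is_basis_iff_det.2 (isUnit_iff_ne_zero.2 (abs_pos.1 hpos))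
  refine ⟨v, Module.Basis.mk hvli hvsp.ge, fun j => by simp, fun i j => ?_⟩
  have h := congrArg (fun f => f (p i)) (b₁.det_smul_mk_coord_eq_det_update hvli hvsp.ge j)
  have h' : b₁.det (p ∘ v) * (Module.Basis.mk hvli hvsp.ge).repr (p i) j =
      b₁.det (p ∘ Function.update v j i) := by
    rw [Function.comp_update]
    simpa using h
  have hle := hv (Function.update v j i)
  rw [← h', abs_mul] at hle
  exact le_of_mul_le_mul_left (by simpa using hle) hpos

/-- A finite spanning family with zero sum has `2d` members that control, up to a linear factor,
all its members from the point of view of linear functionals. -/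
theorem exists_card_le_two_mul_finrank_abs_le {ι V : Type*} [Fintype ι] [AddCommGroup V]
    [Module ℝ V] [FiniteDimensional ℝ V] (p : ι → V)
    (hp : Submodule.span ℝ (Set.range p) = ⊤) (hsum : ∑ i, p i = 0) :
    ∃ T : Finset ι, T.card ≤ 2 * Module.finrank ℝ V ∧ ∀ f : V →ₗ[ℝ] ℝ,
      (∀ i ∈ T, f (p i) ≤ 1) → ∀ i, |f (p i)| ≤ Fintype.card ι + Module.finrank ℝ V := by
  classical
  obtain ⟨v, b, hbv, hb⟩ := exists_basis_abs_repr_le_one p hp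
  have hvinj : Function.Injective v := fun i j hij => b.injective (by rw [hbv, hbv, hij])
  let S := Finset.univ.image v
  have hScard : S.card = Module.finrank ℝ V := by
    simp [S, Finset.card_image_of_injective _ hvinj]
  obtain ⟨t, -, w, hw, hwp, hwle, ht⟩ :=
    exists_linearIndepOn_nonneg_combination p Sᶜ (fun _ => 1) (fun _ _ => zero_le_one)
  have htcard : t.card ≤ Module.finrank ℝ V := by
    have := LinearIndependent.fintype_card_le_finrank ht
    simpa using this
  refine ⟨S ∪ t, (Finset.card_union_le _ _).trans (by omega), fun f hf i => ?_⟩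
  have hcompl : ((Sᶜ.card : ℕ) : ℝ) = Fintype.card ι - Module.finrank ℝ V := by
    rw [Finset.card_compl, hScard, Nat.cast_sub (hScard ▸ S.card_le_univ)]
  have hlower : -∑ j, f (b j) ≤ Fintype.card ι - Module.finrank ℝ V := by
    have h1 : ∑ j, b j = ∑ i ∈ S, p i := by
      rw [Finset.sum_image hvinj.injOn]
      exact Finset.sum_congr rfl fun j _ => hbv j
    have h2 : ∑ i ∈ t, w i • p i = -∑ j, b j := by
      rw [hwp, h1, eq_neg_iff_add_eq_zero, add_comm]
      simpa [hsum] using Finset.sum_add_sum_compl S p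
    have h3 : ∑ i ∈ t, w i * f (p i) = -∑ j, f (b j) := by
      simpa using congrArg f h2
    rw [← h3, ← hcompl]
    calc ∑ i ∈ t, w i * f (p i) ≤ ∑ i ∈ t, w i := Finset.sum_le_sum fun i hi =>
          mul_le_of_le_one_right (hw i hi) (hf i (Finset.mem_union_right _ hi))
      _ ≤ _ := by simpa using hwle
  have hupper : ∀ j, f (b j) ≤ 1 := fun j => by
    rw [hbv]
    exact hf _ (Finset.mem_union_left _ (Finset.mem_image_of_mem v (Finset.mem_univ j)))
  calc |f (p i)| = |∑ j, b.repr (p i) j * f (b j)| := by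
        conv_lhs => rw [← b.sum_repr (p i)]
        simp only [map_sum, map_smul, smul_eq_mul]
    _ ≤ ∑ j, |b.repr (p i) j * f (b j)| := Finset.abs_sum_le_sum_abs _ _
    _ ≤ ∑ j, (2 - f (b j)) := by
        refine Finset.sum_le_sum fun j _ => ?_
        rw [abs_mul]
        refine (mul_le_of_le_one_left (abs_nonneg _) (hb i j)).trans (abs_le.2 ?_)
        constructor <;> linarith [hupper j]
    _ ≤ _ := by
        rw [Finset.sum_sub_distrib]
        simp only [Finset.sum_const, Finset.card_univ, Fintype.card_fin, nsmul_eq_mul]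
        linarith

/-- The analytic center of a bounded polytope: the vertices of the polar with respect to this
point have zero sum. -/
theorem exists_sum_inv_one_sub_inner_smul_eq_zero {ι E : Type*} [Fintype ι]
    [NormedAddCommGroup E] [InnerProductSpace ℝ E] [FiniteDimensional ℝ E] (q : ι → E) (R : ℝ)
    (hR : ∀ x, (∀ i, inner ℝ (q i) x ≤ 1) → ‖x‖ ≤ R) :
    ∃ z, (∀ i, inner ℝ (q i) z < 1) ∧ ∑ i, (1 - inner ℝ (q i) z)⁻¹ • q i = 0 := by
  classical
  let L : Set E := {x | ∀ i, inner ℝ (q i) x ≤ 1}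
  have hLc : IsCompact L := by
    refine (isCompact_closedBall (0 : E) R).of_isClosed_subset ?_ fun x hx => by
      simpa using hR x hx
    simp only [L, Set.ofPred_forall]
    exact isClosed_iInter fun i => isClosed_le (by fun_prop) continuous_const
  let F : E → ℝ := fun x => ∏ i, (1 - inner ℝ (q i) x)
  obtain ⟨z, hzL, hz⟩ := hLc.exists_isMaxOn (f := F) ⟨0, by simp [L]⟩ (by fun_prop)
  have hFz : 0 < F z := by
    have : F 0 ≤ F z := hz (show (0 : E) ∈ L by simp [L])
    simp only [F, inner_zero_right, sub_zero, Finset.prod_const_one] at this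
    exact zero_lt_one.trans_le this
  have hz1 : ∀ i, inner ℝ (q i) z < 1 := fun i =>
    lt_of_le_of_ne (hzL i) fun h => hFz.ne' (Finset.prod_eq_zero (Finset.mem_univ i) (by simp [h]))
  refine ⟨z, hz1, ext_inner_right ℝ fun h => ?_⟩
  have hmax : IsLocalMax (fun t : ℝ => ∏ i, (1 - inner ℝ (q i) (z + t • h))) 0 := by
    have : ∀ᶠ t : ℝ in nhds 0, ∀ i, inner ℝ (q i) (z + t • h) < 1 := by
      refine Filter.eventually_all.2 fun i => ?_
      have hc : Continuous fun t : ℝ => inner ℝ (q i) (z + t • h) := by fun_prop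
      exact hc.continuousAt.eventually_lt continuousAt_const (by simpa using hz1 i)
    filter_upwards [this] with t ht
    simpa using hz (show z + t • h ∈ L from fun i => (ht i).le)
  have hderiv : HasDerivAt (fun t : ℝ => ∏ i, (1 - inner ℝ (q i) (z + t • h)))
      (∑ i, (∏ j ∈ Finset.univ.erase i, (1 - inner ℝ (q j) (z + (0 : ℝ) • h))) •
        (-inner ℝ (q i) h)) 0 := by
    refine HasDerivAt.fun_finsetProd fun i _ => ?_
    simp only [inner_add_right, inner_smul_right]
    simpa using (((hasDerivAt_id (0 : ℝ)).mul_const (inner ℝ (q i) h)).const_add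
      (inner ℝ (q i) z)).const_sub 1
  have h0 := hmax.hasDerivAt_eq_zero hderiv
  have hF : ∀ i, ∏ j ∈ Finset.univ.erase i, (1 - inner ℝ (q j) z) =
      F z * (1 - inner ℝ (q i) z)⁻¹ := fun i => by
    rw [eq_mul_inv_iff_mul_eq₀ (sub_pos.2 (hz1 i)).ne']
    exact Finset.prod_erase_mul _ (fun j => 1 - inner ℝ (q j) z) (Finset.mem_univ i)
  simp only [zero_smul, add_zero, hF, smul_eq_mul, mul_neg, Finset.sum_neg_distrib, neg_eq_zero,
    mul_assoc, ← Finset.mul_sum] at h0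
  simpa [sum_inner, inner_smul_left] using (mul_eq_zero.1 h0).resolve_left hFz.ne'

/-- From finitely many halfspaces with intersection of norm at most `R`, one can select `2d` whose
intersection is larger by at most a linear factor. -/
theorem exists_card_le_two_mul_finrank_norm_le {ι E : Type*} [Fintype ι]
    [NormedAddCommGroup E] [InnerProductSpace ℝ E] [FiniteDimensional ℝ E] (q : ι → E) (R : ℝ)
    (hR : ∀ x, (∀ i, inner ℝ (q i) x ≤ 1) → ‖x‖ ≤ R) :
    ∃ T : Finset ι, T.card ≤ 2 * Module.finrank ℝ E ∧
      ∀ u, (∀ i ∈ T, inner ℝ (q i) u ≤ 1) →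
        ‖u‖ ≤ (2 * (Fintype.card ι + Module.finrank ℝ E) + 1) * R := by
  obtain ⟨z, hz, hsum⟩ := exists_sum_inv_one_sub_inner_smul_eq_zero q R hR
  have hz' : ∀ i, 0 < 1 - inner ℝ (q i) z := fun i => sub_pos.2 (hz i)
  have hspan : Submodule.span ℝ (Set.range fun i => (1 - inner ℝ (q i) z)⁻¹ • q i) = ⊤ := by
    rw [← Submodule.orthogonal_eq_bot_iff, Submodule.eq_bot_iff]
    intro x hx
    have hx0 : ∀ i, inner ℝ (q i) x = 0 := fun i => by
      have := Submodule.inner_right_of_mem_orthogonal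
        (Submodule.subset_span (Set.mem_range_self i)) hx
      simpa [inner_smul_left, (hz' i).ne'] using this
    by_contra hne
    have := hR (((|R| + 1) / ‖x‖) • x) fun i => by simp [inner_smul_right, hx0]
    rw [norm_smul, norm_div, norm_norm, div_mul_cancel₀ _ (norm_ne_zero_iff.2 hne),
      Real.norm_of_nonneg (by positivity)] at this
    linarith [le_abs_self R]
  obtain ⟨T, hTcard, hT⟩ := exists_card_le_two_mul_finrank_abs_le _ hspan hsum
  refine ⟨T, hTcard, fun u hu => ?_⟩
  have hzR : ‖z‖ ≤ R := hR z fun i => (hz i).le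
  have hR0 : 0 ≤ R := (norm_nonneg z).trans hzR
  set C : ℝ := Fintype.card ι + Module.finrank ℝ E with hC
  have hC0 : 0 ≤ C := by positivity
  have hbound : ∀ i, inner ℝ (q i) (u - z) ≤ C * (1 - inner ℝ (q i) z) := by
    have := hT (innerₛₗ ℝ (u - z)) fun i hi => by
      have := hu i hi
      simp only [innerₛₗ_apply_apply, inner_smul_right]
      rw [real_inner_comm _ (u - z), inv_mul_le_one₀ (hz' i), inner_sub_right]
      linarith
    intro i
    have h := (abs_le.1 (this i)).2
    simp only [innerₛₗ_apply_apply, inner_smul_right] at h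
    rwa [real_inner_comm _ (u - z), inv_mul_le_iff₀ (hz' i), mul_comm] at h
  rcases hC0.eq_or_lt with h0 | hpos
  · have : Module.finrank ℝ E = 0 := by
      have h1 : (0 : ℝ) ≤ Fintype.card ι := by positivity
      have h2 : (0 : ℝ) ≤ Module.finrank ℝ E := by positivity
      exact_mod_cast (by linarith : (Module.finrank ℝ E : ℝ) = 0)
    have := Module.finrank_zero_iff.1 this
    rw [Subsingleton.elim u 0, norm_zero]
    positivity
  have hw : ‖z + C⁻¹ • (u - z)‖ ≤ R := hR _ fun i => by
    rw [inner_add_right, inner_smul_right]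
    have := (inv_mul_le_iff₀ hpos).2 (hbound i)
    linarith
  have hu' : u = z + C • ((z + C⁻¹ • (u - z)) - z) := by
    rw [add_sub_cancel_left, smul_inv_smul₀ hpos.ne', add_sub_cancel]
  calc ‖u‖ = ‖z + C • ((z + C⁻¹ • (u - z)) - z)‖ := by rw [← hu']
    _ ≤ ‖z‖ + C * (‖z + C⁻¹ • (u - z)‖ + ‖z‖) := by
        refine (norm_add_le _ _).trans ?_
        rw [norm_smul, Real.norm_of_nonneg hC0]
        gcongr
        exact norm_sub_le _ _
    _ ≤ R + C * (R + R) := by gcongr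
    _ = _ := by ring

/-- If `Q` is a set of `α·d` points in `ℝ^d` (with `α > 1` and `α·d` a positive integer)
whose convex hull contains the ball `λ·B^d`, then there is a subset `Q' ⊆ Q` of at most
`2d` points whose convex hull contains the ball `(λ/(5αd))·B^d`. -/
theorem steinitz_linear_number_of_points (d : ℕ) (hd : 1 ≤ d) (α : ℝ) (hα : 1 < α)
    (Q : Finset (EuclideanSpace ℝ (Fin d))) (hcard : (Q.card : ℝ) = α * d)
    (lam : ℝ) (hlam : 0 < lam)
    (hQ : closedBall (0 : EuclideanSpace ℝ (Fin d)) lam ⊆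
        convexHull ℝ (Q : Set (EuclideanSpace ℝ (Fin d)))) :
    ∃ Q' ⊆ Q, Q'.card ≤ 2 * d ∧
      closedBall (0 : EuclideanSpace ℝ (Fin d)) (lam / (5 * α * d)) ⊆
        convexHull ℝ (Q' : Set (EuclideanSpace ℝ (Fin d))) := by
  have hR : ∀ x, (∀ i : Q, inner ℝ (i : EuclideanSpace ℝ (Fin d)) x ≤ 1) → ‖x‖ ≤ lam⁻¹ := by
    intro x hx
    rcases eq_or_ne x 0 with rfl | hx0
    · simpa using hlam.le
    have hxn : 0 < ‖x‖ := norm_pos_iff.2 hx0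
    have hmem : (lam / ‖x‖) • x ∈ convexHull ℝ (Q : Set (EuclideanSpace ℝ (Fin d))) := hQ <| by
      rw [mem_closedBall_zero_iff, norm_smul, norm_div, norm_norm, div_mul_cancel₀ _ hxn.ne',
        Real.norm_of_nonneg hlam.le]
    have hconv : Convex ℝ {y : EuclideanSpace ℝ (Fin d) | inner ℝ x y ≤ 1} :=
      convex_halfSpace_le (innerₛₗ ℝ x).isLinear 1
    have := convexHull_min (fun y hy => by
      simpa [real_inner_comm] using hx ⟨y, hy⟩) hconv hmem
    rw [Set.mem_ofPred_eq, inner_smul_right, real_inner_self_eq_norm_mul_norm, ← mul_assoc,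
      div_mul_cancel₀ _ hxn.ne'] at this
    rwa [← one_div, le_div_iff₀' hlam]
  obtain ⟨T, hTcard, hT⟩ :=
    exists_card_le_two_mul_finrank_norm_le (fun i : Q => (i : EuclideanSpace ℝ (Fin d))) _ hR
  rw [finrank_euclideanSpace_fin, Fintype.card_coe, hcard] at hT
  rw [finrank_euclideanSpace_fin] at hTcard
  have hd' : (1 : ℝ) ≤ d := by exact_mod_cast hd
  have hαd : (d : ℝ) + 1 ≤ α * d := by
    rw [← hcard]
    have : (d : ℝ) < Q.card := by rw [hcard]; nlinarith
    exact_mod_cast this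
  refine ⟨T.map (Function.Embedding.subtype _), fun y hy => ?_, by simpa using hTcard,
    fun x hx => ?_⟩
  · obtain ⟨i, -, rfl⟩ := Finset.mem_map.1 hy
    exact i.2
  by_contra hxT
  obtain ⟨f, c, hfT, hfx⟩ := geometric_hahn_banach_closed_point (convex_convexHull ℝ _)
    ((Finset.finite_toSet _).isClosed_convexHull ℝ) hxT
  obtain ⟨g, rfl⟩ := (InnerProductSpace.toDual ℝ _).surjective f
  simp only [InnerProductSpace.toDual_apply_apply] at hfT hfx
  have hε : 0 < lam / (5 * α * d) := by positivity
  set ε := lam / (5 * α * d) with hεdef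
  have hgx : inner ℝ g x ≤ ε * ‖g‖ := by
    rw [mem_closedBall_zero_iff] at hx
    calc inner ℝ g x ≤ ‖g‖ * ‖x‖ := real_inner_le_norm g x
      _ ≤ _ := by rw [mul_comm]; gcongr
  have hgT : ∀ i ∈ T, inner ℝ (i : EuclideanSpace ℝ (Fin d)) g ≤ ε * ‖g‖ := fun i hi => by
    rw [real_inner_comm]
    exact ((hfT i (subset_convexHull ℝ _ (by simpa using hi))).trans hfx).le.trans hgx
  rcases eq_or_ne g 0 with rfl | hg0
  · have := hT (((2 * (α * d + d) + 1) * lam⁻¹ + 1) • EuclideanSpace.single ⟨0, hd⟩ 1)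
      fun i hi => by
        have := hfT i (subset_convexHull ℝ _ (by simpa using hi))
        simp only [inner_zero_left] at this hfx
        linarith
    rw [norm_smul, PiLp.norm_single, norm_one, mul_one,
      Real.norm_of_nonneg (by positivity)] at this
    linarith
  have hgn : 0 < ‖g‖ := norm_pos_iff.2 hg0
  have := hT ((ε * ‖g‖)⁻¹ • g) fun i hi => by
    rw [inner_smul_right]
    exact (inv_mul_le_one₀ (by positivity)).2 (hgT i hi)
  rw [norm_smul, Real.norm_of_nonneg (by positivity), mul_inv, mul_assoc,
    inv_mul_cancel₀ hgn.ne', mul_one, hεdef, inv_div, div_eq_mul_inv] at this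
  have := le_of_mul_le_mul_right this (inv_pos.2 hlam)
  nlinarith
end

section
/- Let d ≥ 1 and let Q be a convex polytope in ℝ^d (the convex hull of a finite set) containing the closed Euclidean unit ball B^d. Then there exist at most 2d vertices of Q (i.e., extreme points of Q) whose convex hull contains the ball (d^{-5/2}/7)·B^d. -/
open Metric

open Module in
/-- A compact spanning set contains a basis in which all its points have coordinates in `[-1, 1]`
(an Auerbach-type basis, obtained by maximising the determinant). -/
theorem IsCompact.exists_basis_abs_repr_le_one {E : Type*} [NormedAddCommGroup E]
    [NormedSpace ℝ E] [FiniteDimensional ℝ E] {C : Set E} (hC : IsCompact C)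
    (hspan : Submodule.span ℝ C = ⊤) {n : ℕ} (hn : finrank ℝ E = n) :
    ∃ b : Basis (Fin n) ℝ E,
      (∀ i, b i ∈ C) ∧ ∀ x ∈ C, ∀ i, |b.repr x i| ≤ 1 := by
  classical
  obtain ⟨s, hsC, hss, hsi⟩ := exists_linearIndependent ℝ C
  let e₁ : Basis s ℝ E := Basis.mk hsi (by simp [hss, hspan])
  have : Fintype s := FiniteDimensional.fintypeBasisIndex e₁
  let e : Basis (Fin n) ℝ E :=
    e₁.reindex (Fintype.equivFinOfCardEq ((finrank_eq_card_basis e₁).symm.trans hn))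
  have heC : ∀ i, e i ∈ C := fun i => by
    simp only [e, Basis.reindex_apply, e₁, Basis.mk_apply]
    exact hsC (Subtype.coe_prop _)
  have hcont : Continuous fun v : Fin n → E => |e.det v| := by
    simp only [Basis.det_apply]
    refine (Continuous.matrix_det (continuous_matrix fun i j => ?_)).abs
    exact (LinearMap.continuous_of_finiteDimensional (e.coord i)).comp (continuous_apply j)
  obtain ⟨v, hvC, hvmax⟩ := (isCompact_univ_pi fun _ : Fin n => hC).exists_isMaxOn
    ⟨e, fun i _ => heC i⟩ hcont.continuousOn
  have hv1 : 1 ≤ |e.det v| := by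
    have := hvmax (show (e : Fin n → E) ∈ Set.univ.pi fun _ => C from fun i _ => heC i)
    simpa [e.det_self] using this
  have hv0 : 0 < |e.det v| := by linarith
  obtain ⟨hli, hsp⟩ := e.is_basis_iff_det.mpr (isUnit_iff_ne_zero.mpr (abs_pos.mp hv0))
  refine ⟨Basis.mk hli hsp.ge, fun i => by simpa using hvC i trivial, fun x hx i => ?_⟩
  have key := LinearMap.congr_fun (e.det_smul_mk_coord_eq_det_update hli hsp.ge i) x
  have hmax : |e.det (Function.update v i x)| ≤ |e.det v| := by
    refine hvmax fun j _ => ?_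
    rcases eq_or_ne j i with rfl | h
    · simpa using hx
    · simpa [h] using hvC j trivial
  simp only [LinearMap.smul_apply, smul_eq_mul, MultilinearMap.toLinearMap_apply,
    Basis.coord_apply] at key
  replace key : e.det v * (Basis.mk hli hsp.ge).repr x i = e.det (Function.update v i x) := key
  rw [← key, abs_mul] at hmax
  exact le_of_mul_le_mul_left (by simpa using hmax) hv0

open Module in
/-- The centroid `c` of a simplex of maximal volume in `K` satisfies `K - c ⊆ -d (K - c)`. -/
theorem exists_center_neg_inv_smul_mem {E : Type*} [NormedAddCommGroup E] [NormedSpace ℝ E]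
    [FiniteDimensional ℝ E] {K : Set E} (hK : IsCompact K) (hconv : Convex ℝ K) {ε : ℝ}
    (hε : 0 < ε) (hball : closedBall 0 ε ⊆ K) (hE : 0 < finrank ℝ E) :
    ∃ c ∈ K, ∀ x ∈ K, c - (finrank ℝ E : ℝ)⁻¹ • (x - c) ∈ K := by
  have h0 : (0 : E) ∈ K := hball (by simp [hε.le])
  have hspan : Submodule.span ℝ (({1} : Set ℝ) ×ˢ K) = ⊤ := by
    rw [eq_top_iff]
    rintro ⟨t, x⟩ -
    have hmem : ∀ y ∈ K, ((1 : ℝ), y) ∈ Submodule.span ℝ (({1} : Set ℝ) ×ˢ K) := fun y hy =>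
      Submodule.subset_span ⟨rfl, hy⟩
    have hy : (ε * (‖x‖ + 1)⁻¹) • x ∈ K := hball (by
      rw [mem_closedBall_zero_iff, norm_smul, Real.norm_of_nonneg (by positivity), mul_assoc]
      have : (‖x‖ + 1)⁻¹ * ‖x‖ ≤ 1 := by
        rw [inv_mul_le_iff₀ (by positivity)]
        linarith
      nlinarith)
    have hx : (t, x) = t • ((1 : ℝ), (0 : E)) + (ε * (‖x‖ + 1)⁻¹)⁻¹ •
        (((1 : ℝ), (ε * (‖x‖ + 1)⁻¹) • x) - ((1 : ℝ), (0 : E))) := by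
      have : ε * (‖x‖ + 1)⁻¹ ≠ 0 := by positivity
      ext
      · simp
      · simp only [Prod.mk_sub_mk, Prod.smul_mk, Prod.mk_add_mk, sub_zero, smul_zero, zero_add]
        rw [inv_smul_smul₀ this]
    rw [hx]
    exact add_mem (Submodule.smul_mem _ _ (hmem 0 h0))
      (Submodule.smul_mem _ _ (sub_mem (hmem _ hy) (hmem 0 h0)))
  set d := finrank ℝ E
  obtain ⟨n, hcard⟩ : ∃ n, n = d + 1 := ⟨_, rfl⟩
  obtain ⟨b, hb, hrepr⟩ := (isCompact_singleton.prod hK).exists_basis_abs_repr_le_one hspan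
    (n := n) (by rw [finrank_prod, finrank_self, hcard, add_comm])
  have hd : (0 : ℝ) < d := by exact_mod_cast hE
  have hn : (n : ℝ) = d + 1 := by exact_mod_cast hcard
  have hb1 : ∀ i, (b i).1 = 1 := fun i => (hb i).1
  have hb2 : ∀ i, (b i).2 ∈ K := fun i => (hb i).2
  refine ⟨∑ i, (n : ℝ)⁻¹ • (b i).2, hconv.sum_mem (fun _ _ => by positivity) ?_ fun i _ => hb2 i,
    fun x hx => ?_⟩
  · rw [Finset.sum_const, Finset.card_univ, Fintype.card_fin, nsmul_eq_mul]
    exact mul_inv_cancel₀ (by rw [hn]; positivity)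
  have hsum := b.sum_repr ((1 : ℝ), x)
  have hs1 : ∑ i, b.repr ((1 : ℝ), x) i = 1 := by
    have := congrArg Prod.fst hsum
    simp only [Prod.fst_sum, Prod.smul_fst, hb1, smul_eq_mul, mul_one] at this
    exact this
  have hs2 : ∑ i, b.repr ((1 : ℝ), x) i • (b i).2 = x := by
    have := congrArg Prod.snd hsum
    simp only [Prod.snd_sum, Prod.smul_snd] at this
    exact this
  have heq : (∑ i, (n : ℝ)⁻¹ • (b i).2) - (d : ℝ)⁻¹ • (x - ∑ i, (n : ℝ)⁻¹ • (b i).2) =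
      ∑ i, ((d : ℝ)⁻¹ * (1 - b.repr ((1 : ℝ), x) i)) • (b i).2 := by
    conv_lhs => rw [← hs2]
    rw [← Finset.sum_sub_distrib, Finset.smul_sum, ← Finset.sum_sub_distrib]
    refine Finset.sum_congr rfl fun i _ => ?_
    rw [← sub_smul, smul_smul, ← sub_smul]
    congr 1
    rw [hn]
    field_simp
    ring
  rw [heq]
  refine hconv.sum_mem (fun i _ => ?_) ?_ fun i _ => hb2 i
  · have := (abs_le.mp (hrepr (1, x) ⟨rfl, hx⟩ i)).2
    exact mul_nonneg (by positivity) (by linarith)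
  · rw [← Finset.mul_sum, Finset.sum_sub_distrib, hs1, Finset.sum_const, Finset.card_univ,
      Fintype.card_fin, nsmul_eq_mul, hn]
    field_simp
    ring

open Module in
/-- Conic Carathéodory theorem with control on the total weight. -/
theorem exists_subset_card_le_finrank_sum_smul_eq {ι E : Type*} [AddCommGroup E] [Module ℝ E]
    [FiniteDimensional ℝ E] (w : ι → E) (S : Finset ι) (a : ι → ℝ) (ha : ∀ i ∈ S, 0 ≤ a i) :
    ∃ T ⊆ S, T.card ≤ finrank ℝ E ∧ ∃ a' : ι → ℝ, (∀ i ∈ T, 0 ≤ a' i) ∧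
      ∑ i ∈ T, a' i • w i = ∑ i ∈ S, a i • w i ∧ ∑ i ∈ T, a' i ≤ ∑ i ∈ S, a i := by
  classical
  induction S using Finset.strongInduction generalizing a with
  | H S ih =>
  by_cases hS : S.card ≤ finrank ℝ E
  · exact ⟨S, subset_rfl, hS, a, ha, rfl, le_rfl⟩
  have hrel : ∃ g : ι → ℝ, ∑ i ∈ S, g i • w i = 0 ∧ ∃ i ∈ S, g i ≠ 0 := by
    have hdep : ¬ LinearIndependent ℝ fun i : S => w i := fun h =>
      hS (by simpa using h.fintype_card_le_finrank)
    obtain ⟨g, hg, i, hi⟩ := Fintype.not_linearIndependent_iff.mp hdep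
    refine ⟨fun j => if hj : j ∈ S then g ⟨j, hj⟩ else 0, ?_, i, i.2, by simpa using hi⟩
    rw [← Finset.sum_coe_sort, ← hg]
    exact Finset.sum_congr rfl fun j _ => by simp
  have hpos : ∃ g : ι → ℝ, ∑ i ∈ S, g i • w i = 0 ∧ 0 ≤ ∑ i ∈ S, g i ∧ ∃ i ∈ S, 0 < g i := by
    obtain ⟨g, hg, hne⟩ := hrel
    wlog hsum : 0 ≤ ∑ i ∈ S, g i generalizing g
    · refine this (-g) (by simp [hg]) (by simpa using hne) ?_
      simp only [Pi.neg_apply, Finset.sum_neg_distrib]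
      linarith
    refine ⟨g, hg, hsum, ?_⟩
    by_contra! hle
    obtain ⟨i, hi, hgi⟩ := hne
    exact hgi ((Finset.sum_eq_zero_iff_of_nonpos hle).mp
      (le_antisymm (Finset.sum_nonpos hle) hsum) i hi)
  obtain ⟨g, hg, hsum, i, hi, hgi⟩ := hpos
  obtain ⟨k, hk, hmin⟩ := (S.filter fun i => 0 < g i).exists_min_image (fun i => a i / g i)
    ⟨i, by simp [hi, hgi]⟩
  obtain ⟨hkS, hgk⟩ := Finset.mem_filter.mp hk
  have hr : 0 ≤ a k / g k := div_nonneg (ha k hkS) hgk.le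
  have hzero : a k - a k / g k * g k = 0 := by field_simp; ring
  obtain ⟨T, hTS, hT, a', ha', hw, hs⟩ := ih (S.erase k) (Finset.erase_ssubset hkS)
    (fun i => a i - a k / g k * g i) fun i hi => by
      have hiS := Finset.mem_of_mem_erase hi
      rcases lt_or_ge 0 (g i) with h | h
      · have := hmin i (by simp [hiS, h])
        rw [le_div_iff₀ h] at this
        linarith
      · nlinarith [ha i hiS, mul_nonneg hr (neg_nonneg.mpr h)]
  refine ⟨T, hTS.trans (Finset.erase_subset _ _), hT, a', ha', ?_, ?_⟩
  · rw [hw, Finset.sum_erase _ (by rw [hzero, zero_smul])]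
    simp only [sub_smul, mul_smul, Finset.sum_sub_distrib, ← Finset.smul_sum, hg]
    simp
  · refine hs.trans ?_
    rw [Finset.sum_erase S (f := fun i => a i - a k / g k * g i) hzero,
      Finset.sum_sub_distrib, ← Finset.mul_sum]
    nlinarith [mul_nonneg hr hsum]

/-- A point in the convex hull of `0` and a finite family is a subconvex combination. -/
theorem exists_weights_of_mem_convexHull_insert_zero {ι E : Type*} [AddCommGroup E] [Module ℝ E]
    (w : ι → E) (S : Finset ι) {x : E} (hx : x ∈ convexHull ℝ (insert 0 (w '' S))) :
    ∃ a : ι → ℝ, (∀ i ∈ S, 0 ≤ a i) ∧ ∑ i ∈ S, a i • w i = x ∧ ∑ i ∈ S, a i ≤ 1 := by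
  classical
  let D : Set E := {x | ∃ a : ι → ℝ, (∀ i ∈ S, 0 ≤ a i) ∧
    ∑ i ∈ S, a i • w i = x ∧ ∑ i ∈ S, a i ≤ 1}
  have hD : Convex ℝ D := by
    rintro x ⟨a, ha, rfl, hsa⟩ y ⟨b, hb, rfl, hsb⟩ s t hs ht hst
    refine ⟨fun i => s * a i + t * b i, fun i hi => ?_, ?_, ?_⟩
    · exact add_nonneg (mul_nonneg hs (ha i hi)) (mul_nonneg ht (hb i hi))
    · simp only [add_smul, mul_smul, Finset.sum_add_distrib, Finset.smul_sum]
    · rw [Finset.sum_add_distrib, ← Finset.mul_sum, ← Finset.mul_sum]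
      nlinarith
  refine convexHull_min (t := D) ?_ hD hx
  rintro y (rfl | ⟨i, hi, rfl⟩)
  · exact ⟨0, by simp, by simp, by simp⟩
  · have hi' : i ∈ S := hi
    refine ⟨Pi.single i 1, fun j _ => ?_, ?_, ?_⟩
    · rcases eq_or_ne j i with rfl | h <;> simp [*]
    · rw [Finset.sum_eq_single i] <;> simp +contextual [hi']
    · simp [Finset.sum_pi_single', hi']

section InnerProductSpace

variable {E : Type*} [NormedAddCommGroup E] [InnerProductSpace ℝ E] [FiniteDimensional ℝ E]

/-- A point outside a closed convex set is separated from it by an inner product functional. -/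
theorem exists_inner_lt_of_notMem {H : Set E} (hconv : Convex ℝ H) (hclosed : IsClosed H) {z : E}
    (hz : z ∉ H) : ∃ (y : E) (u : ℝ), (∀ x ∈ H, inner ℝ x y < u) ∧ u < inner ℝ z y := by
  have : CompleteSpace E := FiniteDimensional.complete ℝ E
  obtain ⟨f, u, hf, hfz⟩ := geometric_hahn_banach_closed_point hconv hclosed hz
  have hinner : ∀ x, inner ℝ x ((InnerProductSpace.toDual ℝ E).symm f) = f x := fun x => by
    rw [real_inner_comm, InnerProductSpace.toDual_symm_apply]
  exact ⟨(InnerProductSpace.toDual ℝ E).symm f, u, fun x hx => by rw [hinner]; exact hf x hx,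
    by rw [hinner]; exact hfz⟩

/-- A point outside a closed convex set containing the origin is cut off by a point of the polar. -/
theorem exists_polar_one_lt_inner {H : Set E} (hconv : Convex ℝ H) (hclosed : IsClosed H)
    (h0 : (0 : E) ∈ H) {z : E} (hz : z ∉ H) :
    ∃ y : E, (∀ x ∈ H, inner ℝ x y ≤ 1) ∧ 1 < inner ℝ z y := by
  obtain ⟨y, u, hy, hyz⟩ := exists_inner_lt_of_notMem hconv hclosed hz
  have hu : 0 < u := by simpa using hy 0 h0
  refine ⟨u⁻¹ • y, fun x hx => ?_, ?_⟩
  · rw [inner_smul_right, inv_mul_le_iff₀ hu]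
    linarith [hy x hx]
  · rw [inner_smul_right, lt_inv_mul_iff₀ hu]
    linarith

/-- If the polar of a finite set lies in the ball of radius `R`, then its convex hull contains the
ball of radius `1 / R`. -/
theorem closedBall_inv_subset_convexHull [Nontrivial E] (T : Finset E) {R : ℝ} (hR : 0 < R)
    (hpolar : ∀ y : E, (∀ v ∈ T, inner ℝ v y ≤ 1) → ‖y‖ ≤ R) :
    closedBall 0 R⁻¹ ⊆ convexHull ℝ (T : Set E) := by
  have hclosed : IsClosed (convexHull ℝ (T : Set E)) := T.finite_toSet.isClosed_convexHull ℝ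
  have hne : T.Nonempty := by
    by_contra h
    rw [Finset.not_nonempty_iff_eq_empty] at h
    obtain ⟨y, hy⟩ := NormedSpace.exists_lt_norm ℝ E R
    exact absurd (hpolar y (by simp [h])) (not_le.mpr hy)
  have h0 : (0 : E) ∈ convexHull ℝ (T : Set E) := by
    by_contra h
    obtain ⟨y, u, hy, hu⟩ := exists_inner_lt_of_notMem (convex_convexHull ℝ _) hclosed h
    rw [inner_zero_left] at hu
    have hneg : ∀ v ∈ T, inner ℝ v y < 0 := fun v hv => (hy v (subset_convexHull ℝ _ hv)).trans hu
    have hy0 : 0 < ‖y‖ := by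
      rw [norm_pos_iff]
      rintro rfl
      obtain ⟨v, hv⟩ := hne
      simpa using hneg v hv
    have hbound := hpolar (((R + 1) / ‖y‖) • y) fun v hv => by
      rw [inner_smul_right]
      have : 0 ≤ (R + 1) / ‖y‖ := by positivity
      nlinarith [mul_nonneg this (neg_nonneg.mpr (hneg v hv).le)]
    rw [norm_smul, Real.norm_of_nonneg (by positivity), div_mul_cancel₀ _ hy0.ne'] at hbound
    linarith
  intro p hp
  by_contra hpT
  obtain ⟨y, hy, hpy⟩ := exists_polar_one_lt_inner (convex_convexHull ℝ _) hclosed h0 hpT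
  have hyR := hpolar y fun v hv => hy v (subset_convexHull ℝ _ hv)
  rw [mem_closedBall_zero_iff] at hp
  have : inner ℝ p y ≤ R⁻¹ * R :=
    (real_inner_le_norm p y).trans (mul_le_mul hp hyR (norm_nonneg _) (by positivity))
  rw [inv_mul_cancel₀ hR.ne'] at this
  linarith

open Module in
/-- Quantitative Helly-type selection: if `L = {y | ∀ i ∈ S, ⟪w i, y⟫ ≤ 1}` satisfies
`L ⊆ -d L`, then at most `2d` of its constraints define a set inside `(d² + 2d) L`. -/
theorem exists_subset_card_le_two_mul_finrank {ι : Type*} (w : ι → E) (S : Finset ι)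
    (hspan : Submodule.span ℝ (w '' S) = ⊤)
    (hd : 0 < finrank ℝ E)
    (hsymm : ∀ y : E, (∀ i ∈ S, inner ℝ (w i) y ≤ 1) →
      ∀ i ∈ S, -inner ℝ (w i) y ≤ finrank ℝ E) :
    ∃ T ⊆ S, T.card ≤ 2 * finrank ℝ E ∧ ∀ y : E, (∀ i ∈ T, inner ℝ (w i) y ≤ 1) →
      ∀ i ∈ S, inner ℝ (w i) y ≤ (finrank ℝ E : ℝ) ^ 2 + 2 * finrank ℝ E := by
  classical
  set d := finrank ℝ E with hd_def
  obtain ⟨b, hb, hrepr⟩ :=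
    (S.finite_toSet.image w).isCompact.exists_basis_abs_repr_le_one hspan hd_def.symm
  choose f hfS hfb using hb
  have hd' : (0 : ℝ) < d := by exact_mod_cast hd
  let z : E := -(((d : ℝ) ^ 2)⁻¹ • ∑ i, b i)
  have hzy : ∀ y, inner ℝ z y = -(((d : ℝ) ^ 2)⁻¹ * ∑ i, inner ℝ (b i) y) := fun y => by
    rw [inner_neg_left, real_inner_smul_left, sum_inner]
  have hz : z ∈ convexHull ℝ (insert 0 (w '' S)) := by
    by_contra hz
    obtain ⟨y, hy, hzy1⟩ := exists_polar_one_lt_inner (convex_convexHull ℝ _)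
      (((S.finite_toSet.image w).insert 0).isClosed_convexHull ℝ)
      (subset_convexHull ℝ _ (Set.mem_insert _ _)) hz
    have hL := hsymm y fun i hi =>
      hy _ (subset_convexHull ℝ _ (Set.mem_insert_of_mem _ ⟨i, hi, rfl⟩))
    have hsum : ∑ i, -inner ℝ (b i) y ≤ ∑ _i : Fin d, (d : ℝ) :=
      Finset.sum_le_sum fun i _ => by rw [← hfb i]; exact hL _ (hfS i)
    rw [Finset.sum_neg_distrib, Finset.sum_const, Finset.card_univ, Fintype.card_fin,
      nsmul_eq_mul] at hsum
    rw [hzy, ← mul_neg, lt_inv_mul_iff₀ (by positivity)] at hzy1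
    nlinarith
  obtain ⟨a, ha, haz, ha1⟩ := exists_weights_of_mem_convexHull_insert_zero w S hz
  obtain ⟨T, hTS, hT, a', ha', haz', ha1'⟩ := exists_subset_card_le_finrank_sum_smul_eq w S a ha
  refine ⟨Finset.univ.image f ∪ T, Finset.union_subset ?_ hTS, ?_, fun y hy i hi => ?_⟩
  · intro j hj
    obtain ⟨i, -, rfl⟩ := Finset.mem_image.mp hj
    exact hfS i
  · have h1 : (Finset.univ.image f).card ≤ d := by
      simpa using Finset.card_image_le (s := Finset.univ) (f := f)
    have h2 := Finset.card_union_le (Finset.univ.image f) T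
    omega
  · have hby : ∀ i, inner ℝ (b i) y ≤ 1 := fun i => by
      rw [← hfb i]
      exact hy _ (by simp)
    have hz1 : inner ℝ z y ≤ 1 := by
      rw [← haz, ← haz', sum_inner]
      refine le_trans (Finset.sum_le_sum fun i hi => ?_) (ha1'.trans ha1)
      rw [real_inner_smul_left]
      exact mul_le_of_le_one_right (ha' i hi) (hy i (by simp [hi]))
    have hsum : -∑ i, inner ℝ (b i) y ≤ (d : ℝ) ^ 2 := by
      rw [hzy, ← mul_neg, inv_mul_le_iff₀ (by positivity)] at hz1
      linarith
    have hw : inner ℝ (w i) y = ∑ j, b.repr (w i) j * inner ℝ (b j) y := by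
      conv_lhs => rw [← b.sum_repr (w i)]
      simp_rw [sum_inner, real_inner_smul_left]
    have hle : ∀ j, b.repr (w i) j * inner ℝ (b j) y ≤ 2 - inner ℝ (b j) y := fun j => by
      obtain ⟨h1, h2⟩ := abs_le.mp (hrepr (w i) ⟨i, hi, rfl⟩ j)
      rcases le_total 0 (inner ℝ (b j) y) with h | h <;> nlinarith [hby j]
    rw [hw]
    refine (Finset.sum_le_sum fun j _ => hle j).trans ?_
    rw [Finset.sum_sub_distrib, Finset.sum_const, Finset.card_univ, Fintype.card_fin, nsmul_eq_mul]
    linarith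

/-- If the convex hull of `T` contains the unit ball, then the polar of `T` lies in the unit ball. -/
theorem norm_le_one_of_closedBall_subset_convexHull {E : Type*} [NormedAddCommGroup E]
    [InnerProductSpace ℝ E] {T : Set E} (hball : closedBall 0 1 ⊆ convexHull ℝ T) {y : E}
    (hy : ∀ v ∈ T, inner ℝ v y ≤ 1) : ‖y‖ ≤ 1 := by
  rcases eq_or_ne y 0 with rfl | hy0
  · simp
  have hhalf : Convex ℝ {v : E | inner ℝ v y ≤ 1} :=
    convex_halfSpace_le ⟨fun _ _ => inner_add_left _ _ _, fun _ _ => real_inner_smul_left _ _ _⟩ 1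
  have hmem : ‖y‖⁻¹ • y ∈ closedBall (0 : E) 1 := by
    rw [mem_closedBall_zero_iff, norm_smul, norm_inv, norm_norm,
      inv_mul_cancel₀ (norm_ne_zero_iff.mpr hy0)]
  have : inner ℝ (‖y‖⁻¹ • y) y ≤ 1 :=
    convexHull_min (t := {v : E | inner ℝ v y ≤ 1}) hy hhalf (hball hmem)
  rw [real_inner_smul_left, real_inner_self_eq_norm_sq, sq,
    inv_mul_cancel_left₀ (norm_ne_zero_iff.mpr hy0)] at this
  exact this

open Module in
/-- Quantitative Steinitz theorem for a finite set in a Euclidean space. -/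
theorem exists_subset_card_le_closedBall_subset_convexHull [Nontrivial E] (V : Finset E)
    (hball : closedBall 0 1 ⊆ convexHull ℝ (V : Set E)) :
    ∃ T ⊆ V, T.card ≤ 2 * finrank ℝ E ∧
      closedBall 0 (2 * (finrank ℝ E : ℝ) ^ 2 + 4 * finrank ℝ E + 1)⁻¹ ⊆
        convexHull ℝ (T : Set E) := by
  have : ProperSpace E := FiniteDimensional.proper ℝ E
  have hE : 0 < finrank ℝ E := finrank_pos
  let K : Set E := {y | ∀ v ∈ V, inner ℝ v y ≤ 1}
  have hKnorm : ∀ y ∈ K, ‖y‖ ≤ 1 := fun y hy =>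
    norm_le_one_of_closedBall_subset_convexHull hball hy
  have hKeq : K = ⋂ v ∈ V, {y | inner ℝ v y ≤ 1} := by
    ext y
    simp [K]
  have hKclosed : IsClosed K := by
    rw [hKeq]
    exact isClosed_biInter fun v _ => isClosed_le (by fun_prop) continuous_const
  have hKconv : Convex ℝ K := by
    rw [hKeq]
    exact convex_iInter₂ fun v _ => convex_halfSpace_le
      ⟨fun _ _ => inner_add_right _ _ _, fun _ _ => real_inner_smul_right _ _ _⟩ 1
  have hKcompact : IsCompact K := (isCompact_closedBall (0 : E) 1).of_isClosed_subset hKclosed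
    fun y hy => mem_closedBall_zero_iff.mpr (hKnorm y hy)
  obtain ⟨M, hM0, hM⟩ := V.finite_toSet.isBounded.exists_pos_norm_le
  have hKball : closedBall 0 M⁻¹ ⊆ K := fun y hy v hv => by
    refine (real_inner_le_norm v y).trans ?_
    rw [← mul_inv_cancel₀ hM0.ne']
    exact mul_le_mul (hM v hv) (mem_closedBall_zero_iff.mp hy) (norm_nonneg _) hM0.le
  obtain ⟨c, hcK, hc⟩ :=
    exists_center_neg_inv_smul_mem hKcompact hKconv (inv_pos.mpr hM0) hKball hE
  set d := finrank ℝ E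
  have hd : (0 : ℝ) < d := by exact_mod_cast hE
  have hcV : ∀ v ∈ V, 0 < 1 - inner ℝ v c := fun v hv => by
    have := hc 0 (hKball (by simp [hM0.le])) v hv
    rw [inner_sub_right, real_inner_smul_right, zero_sub, inner_neg_right] at this
    have hd' : 0 < (d : ℝ)⁻¹ := inv_pos.mpr hd
    by_contra! h
    nlinarith
  let w : E → E := fun v => (1 - inner ℝ v c)⁻¹ • v
  have hw : ∀ v ∈ V, ∀ y t, inner ℝ (w v) y ≤ t ↔ inner ℝ v y ≤ (1 - inner ℝ v c) * t :=
    fun v hv y t => by rw [real_inner_smul_left, inv_mul_le_iff₀ (hcV v hv)]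
  have hspan : Submodule.span ℝ (w '' V) = ⊤ := by
    refine Submodule.eq_top_of_nonempty_interior' _ ⟨0, mem_interior_iff_mem_nhds.mpr ?_⟩
    refine Filter.mem_of_superset (closedBall_mem_nhds _ one_pos) (hball.trans ?_)
    refine convexHull_min (fun v hv => ?_) (Submodule.convex _)
    have hv' : v = (1 - inner ℝ v c) • w v := (smul_inv_smul₀ (hcV v hv).ne' v).symm
    rw [hv']
    exact Submodule.smul_mem _ _ (Submodule.subset_span ⟨v, hv, rfl⟩)
  have hshift : ∀ y, (∀ v ∈ V, inner ℝ (w v) y ≤ 1) → c + y ∈ K := fun y hy v hv => by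
    have := (hw v hv y 1).mp (hy v hv)
    rw [inner_add_right]
    linarith
  obtain ⟨T, hTV, hT, hTpolar⟩ := exists_subset_card_le_two_mul_finrank w V hspan hE
    fun y hy v hv => by
      have := hc _ (hshift y hy) v hv
      rw [add_sub_cancel_left, inner_sub_right, real_inner_smul_right] at this
      rw [← inner_neg_right, hw v hv, inner_neg_right]
      have h2 : -((d : ℝ)⁻¹ * inner ℝ v y) ≤ 1 - inner ℝ v c := by linarith
      rwa [← mul_neg, inv_mul_le_iff₀ hd, mul_comm] at h2
  refine ⟨T, hTV, hT, closedBall_inv_subset_convexHull T (by positivity) fun x hx => ?_⟩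
  have hs : (0 : ℝ) < (d : ℝ) ^ 2 + 2 * d := by positivity
  have hxc := hTpolar (x - c) fun v hv => by
    rw [hw v (hTV hv), inner_sub_right]
    linarith [hx v hv]
  have hmem := hKnorm _ (hshift (((d : ℝ) ^ 2 + 2 * d)⁻¹ • (x - c)) fun v hv => by
    rw [real_inner_smul_right, inv_mul_le_iff₀ hs, mul_one]
    exact hxc v hv)
  have hsub : ‖((d : ℝ) ^ 2 + 2 * d)⁻¹ • (x - c)‖ ≤ 2 := by
    have := norm_sub_le (c + ((d : ℝ) ^ 2 + 2 * d)⁻¹ • (x - c)) c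
    rw [add_sub_cancel_left] at this
    linarith [hKnorm c hcK]
  rw [norm_smul, Real.norm_of_nonneg (by positivity), inv_mul_le_iff₀ hs] at hsub
  have := norm_add_le (x - c) c
  rw [sub_add_cancel] at this
  linarith [hKnorm c hcK]

end InnerProductSpace

/-- **Quantitative Steinitz theorem, polynomial bound.**
If `Q` is a convex polytope in `ℝ^d` (the convex hull of a finite set) containing the
closed unit ball, then there are at most `2d` vertices (extreme points) of `Q` whose
convex hull contains the ball of radius `d^(-5/2) / 7`. -/
theorem quantitative_steinitz_five_halves (d : ℕ) (hd : 1 ≤ d)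
    (F : Finset (EuclideanSpace ℝ (Fin d)))
    (Q : Set (EuclideanSpace ℝ (Fin d))) (hQpoly : Q = convexHull ℝ (F : Set (EuclideanSpace ℝ (Fin d))))
    (hball : closedBall (0 : EuclideanSpace ℝ (Fin d)) 1 ⊆ Q) :
    ∃ V : Finset (EuclideanSpace ℝ (Fin d)),
      (V : Set (EuclideanSpace ℝ (Fin d))) ⊆ Q.extremePoints ℝ ∧ V.card ≤ 2 * d ∧
      closedBall (0 : EuclideanSpace ℝ (Fin d)) ((d : ℝ) ^ (-(5 : ℝ) / 2) / 7) ⊆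
        convexHull ℝ (V : Set (EuclideanSpace ℝ (Fin d))) := by
  have : Nonempty (Fin d) := ⟨⟨0, hd⟩⟩
  have hfin : (Q.extremePoints ℝ).Finite :=
    F.finite_toSet.subset (hQpoly ▸ extremePoints_convexHull_subset)
  have hcompact : IsCompact Q := hQpoly ▸ F.finite_toSet.isCompact_convexHull ℝ
  have hhull : convexHull ℝ (hfin.toFinset : Set (EuclideanSpace ℝ (Fin d))) = Q := by
    rw [hfin.coe_toFinset, ← (hfin.isClosed_convexHull ℝ).closure_eq]
    exact closure_convexHull_extremePoints hcompact (hQpoly ▸ convex_convexHull ℝ _)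
  obtain ⟨T, hTV, hT, hTball⟩ :=
    exists_subset_card_le_closedBall_subset_convexHull hfin.toFinset
      (hball.trans hhull.ge)
  rw [finrank_euclideanSpace_fin] at hT hTball
  refine ⟨T, fun v hv => hfin.mem_toFinset.mp (hTV hv), hT,
    (closedBall_subset_closedBall ?_).trans hTball⟩
  have hd1 : (1 : ℝ) ≤ d := by exact_mod_cast hd
  have hpow : (d : ℝ) ^ 2 ≤ (d : ℝ) ^ ((5 : ℝ) / 2) := by
    rw [← Real.rpow_natCast]
    exact Real.rpow_le_rpow_of_exponent_le hd1 (by norm_num)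
  rw [neg_div, Real.rpow_neg (by positivity), div_eq_mul_inv, ← mul_inv]
  exact inv_anti₀ (by positivity) (by nlinarith)
end

section
/- Let P ⊂ ℝ^d be a convex polytope (the convex hull of a finite set) with non-empty interior. Then there exists a point c in the interior of P such that the sum of the extreme points of the polar polytope (P − c)° is equal to zero. -/
open scoped RealInnerProductSpace

/-- The polar of a set `S ⊆ ℝ^d`: all `x` with `⟪x, s⟫ ≤ 1` for every `s ∈ S`. -/
def polarSet {d : ℕ} (S : Set (EuclideanSpace ℝ (Fin d))) : Set (EuclideanSpace ℝ (Fin d)) :=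
  {x | ∀ s ∈ S, ⟪x, s⟫ ≤ 1}

section PolarSet

variable {d : ℕ}

local notation "𝔼" => EuclideanSpace ℝ (Fin d)

/-- The projective map sending the polar of `S` to the polar of the translate `S - t`. -/
noncomputable def polarTranslate {d : ℕ} (t a : EuclideanSpace ℝ (Fin d)) :
    EuclideanSpace ℝ (Fin d) :=
  (1 - ⟪a, t⟫)⁻¹ • a

theorem inner_lt_one_of_mem_polarSet {S : Set 𝔼} {t x : 𝔼} (ht : t ∈ interior S)
    (hx : x ∈ polarSet S) : ⟪x, t⟫ < 1 := by
  rcases eq_or_ne x 0 with rfl | hx0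
  · simp
  have hlim : Filter.Tendsto (fun δ : ℝ => t + δ • x) (nhds 0) (nhds t) := by
    have h : Continuous fun δ : ℝ => t + δ • x := by fun_prop
    simpa using h.tendsto 0
  have hev : ∀ᶠ δ : ℝ in nhds 0, t + δ • x ∈ S :=
    hlim.eventually (mem_interior_iff_mem_nhds.mp ht)
  obtain ⟨δ, hδS, hδ⟩ :=
    ((hev.filter_mono nhdsWithin_le_nhds).and (self_mem_nhdsWithin (s := Set.Ioi (0 : ℝ)))).exists
  have h1 := hx _ hδS
  rw [inner_add_right, inner_smul_right] at h1
  have h2 : 0 < ⟪x, x⟫ := real_inner_self_pos.mpr hx0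
  have h3 := mul_pos (show (0 : ℝ) < δ from hδ) h2
  linarith

theorem polarTranslate_mem_polarSet {S : Set 𝔼} {t a : 𝔼} (ht : t ∈ interior S)
    (ha : a ∈ polarSet S) : polarTranslate t a ∈ polarSet ((fun x => x - t) '' S) := by
  rintro _ ⟨s, hs, rfl⟩
  have h1 : 0 < 1 - ⟪a, t⟫ := sub_pos.mpr (inner_lt_one_of_mem_polarSet ht ha)
  have h2 := ha s hs
  rw [polarTranslate, real_inner_smul_left, inner_sub_right, inv_mul_le_iff₀ h1]
  linarith

theorem polarTranslate_neg_polarTranslate {t a : 𝔼} (ha : ⟪a, t⟫ < 1) :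
    polarTranslate (-t) (polarTranslate t a) = a := by
  have h1 : 1 - ⟪a, t⟫ ≠ 0 := (sub_pos.mpr ha).ne'
  have h2 : 1 - ⟪(1 - ⟪a, t⟫)⁻¹ • a, -t⟫ = (1 - ⟪a, t⟫)⁻¹ := by
    rw [real_inner_smul_left, inner_neg_right]
    field_simp
    ring
  rw [polarTranslate, polarTranslate, h2, inv_inv, smul_inv_smul₀ h1]

theorem neg_mem_interior_image_sub {S : Set 𝔼} (t : 𝔼) (h0 : 0 ∈ interior S) :
    -t ∈ interior ((fun x => x - t) '' S) := by
  have h := (Homeomorph.subRight t).image_interior S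
  simp only [Homeomorph.coe_subRight] at h
  rw [← h]
  exact ⟨0, h0, by simp⟩

theorem image_sub_neg_image_sub (S : Set 𝔼) (t : 𝔼) :
    (fun x => x - -t) '' ((fun x => x - t) '' S) = S := by
  simp [Set.image_image]

theorem polarTranslate_mem_extremePoints {S : Set 𝔼} {t a : 𝔼} (h0 : 0 ∈ interior S)
    (ht : t ∈ interior S) (ha : a ∈ Set.extremePoints ℝ (polarSet S)) :
    polarTranslate t a ∈ Set.extremePoints ℝ (polarSet ((fun x => x - t) '' S)) := by
  have ht' := neg_mem_interior_image_sub t h0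
  have hback : ∀ y ∈ polarSet ((fun x => x - t) '' S),
      polarTranslate (-t) y ∈ polarSet S ∧ polarTranslate t (polarTranslate (-t) y) = y := by
    intro y hy
    refine ⟨by simpa only [image_sub_neg_image_sub] using polarTranslate_mem_polarSet ht' hy, ?_⟩
    simpa using polarTranslate_neg_polarTranslate (inner_lt_one_of_mem_polarSet ht' hy)
  have hpos : ∀ y ∈ polarSet ((fun x => x - t) '' S), 0 < 1 - ⟪y, -t⟫ := fun y hy =>
    sub_pos.mpr (inner_lt_one_of_mem_polarSet ht' hy)
  have hmem := polarTranslate_mem_polarSet ht ha.1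
  refine ⟨hmem, ?_⟩
  rintro y₁ hy₁ y₂ hy₂ ⟨α, β, hα, hβ, hαβ, hy⟩
  have hw := hpos _ hmem
  have hw₁ := hpos _ hy₁
  have hw₂ := hpos _ hy₂
  have haeq := polarTranslate_neg_polarTranslate (inner_lt_one_of_mem_polarSet ht ha.1)
  have key : polarTranslate (-t) y₁ = a := by
    refine ha.2 (hback y₁ hy₁).1 (hback y₂ hy₂).1 ?_
    set y := polarTranslate t a
    have hsum : α * (1 - ⟪y₁, -t⟫) + β * (1 - ⟪y₂, -t⟫) = 1 - ⟪y, -t⟫ := by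
      rw [← hy, inner_add_left, real_inner_smul_left, real_inner_smul_left]
      linear_combination hαβ
    refine ⟨α * (1 - ⟪y₁, -t⟫) / (1 - ⟪y, -t⟫), β * (1 - ⟪y₂, -t⟫) / (1 - ⟪y, -t⟫),
      by positivity, by positivity, ?_, ?_⟩
    · rw [← add_div, hsum, div_self hw.ne']
    · rw [← haeq]
      simp only [polarTranslate, smul_smul]
      rw [← hy, smul_add, smul_smul, smul_smul, hy]
      congr 2 <;> field_simp
  rw [← (hback y₁ hy₁).2, key]

theorem polarTranslate_image_extremePoints {S : Set 𝔼} {t : 𝔼} (h0 : 0 ∈ interior S)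
    (ht : t ∈ interior S) :
    polarTranslate t '' Set.extremePoints ℝ (polarSet S) =
      Set.extremePoints ℝ (polarSet ((fun x => x - t) '' S)) := by
  apply Set.Subset.antisymm
  · rintro _ ⟨a, ha, rfl⟩
    exact polarTranslate_mem_extremePoints h0 ht ha
  · intro y hy
    have ht' := neg_mem_interior_image_sub t h0
    have h0' : (0 : 𝔼) ∈ interior ((fun x => x - t) '' S) := by
      have h := (Homeomorph.subRight t).image_interior S
      simp only [Homeomorph.coe_subRight] at h
      rw [← h]
      exact ⟨t, ht, by simp⟩
    refine ⟨polarTranslate (-t) y, ?_, ?_⟩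
    · simpa only [image_sub_neg_image_sub] using polarTranslate_mem_extremePoints h0' ht' hy
    · simpa using polarTranslate_neg_polarTranslate (inner_lt_one_of_mem_polarSet ht' hy.1)

theorem convex_polarSet (S : Set 𝔼) : Convex ℝ (polarSet S) := by
  intro x hx y hy α β hα hβ hαβ s hs
  rw [inner_add_left, real_inner_smul_left, real_inner_smul_left]
  nlinarith [mul_le_mul_of_nonneg_left (hx s hs) hα, mul_le_mul_of_nonneg_left (hy s hs) hβ]

theorem isCompact_polarSet {S : Set 𝔼} (h0 : 0 ∈ interior S) : IsCompact (polarSet S) := by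
  have hclosed : IsClosed (polarSet S) := by
    have : polarSet S = ⋂ s ∈ S, {x : 𝔼 | ⟪x, s⟫ ≤ 1} := by ext; simp [polarSet]
    rw [this]
    exact isClosed_biInter fun s _ => isClosed_le (by fun_prop) continuous_const
  obtain ⟨ε, hε, hball⟩ := Metric.nhds_basis_closedBall.mem_iff.mp (mem_interior_iff_mem_nhds.mp h0)
  refine Metric.isCompact_of_isClosed_isBounded hclosed
    ((Metric.isBounded_closedBall (x := (0 : 𝔼)) (r := ε⁻¹)).subset fun x hx => ?_)
  rw [mem_closedBall_zero_iff]
  rcases eq_or_ne x 0 with rfl | hx0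
  · simpa using hε.le
  have hn : 0 < ‖x‖ := norm_pos_iff.mpr hx0
  have h := hx ((ε / ‖x‖) • x) (hball (by
    rw [mem_closedBall_zero_iff, norm_smul, Real.norm_of_nonneg (by positivity),
      div_mul_cancel₀ _ hn.ne']))
  rw [inner_smul_right, real_inner_self_eq_norm_sq] at h
  rw [le_inv_comm₀ hn hε, ← one_div, le_div_iff₀ hn]
  calc ε * ‖x‖ = ε / ‖x‖ * ‖x‖ ^ 2 := by field_simp
    _ ≤ 1 := h

theorem polarSet_convexHull (S : Set 𝔼) : polarSet (convexHull ℝ S) = polarSet S := by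
  apply Set.Subset.antisymm
  · exact fun x hx s hs => hx s (subset_convexHull ℝ S hs)
  · intro x hx s hs
    have hconv : Convex ℝ {s : 𝔼 | ⟪x, s⟫ ≤ 1} :=
      convex_halfSpace_le (innerSL ℝ x).toLinearMap.isLinear 1
    exact convexHull_min hx hconv hs

theorem finite_extremePoints_polarSet (F : Finset 𝔼) :
    (Set.extremePoints ℝ (polarSet (F : Set 𝔼))).Finite := by
  classical
  refine Set.Finite.of_injOn (t := (F.powerset : Set (Finset 𝔼)))
    (f := fun x => F.filter fun s => ⟪x, s⟫ = 1)
    (fun x _ => Finset.mem_coe.mpr (Finset.mem_powerset.mpr (Finset.filter_subset _ _)))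
    ?_ F.powerset.finite_toSet
  intro x hx y hy hxy
  have hactive : ∀ s ∈ F, ⟪x, s⟫ = 1 → ⟪y, s⟫ = 1 := fun s hs h =>
    (Finset.mem_filter.mp ((Finset.ext_iff.mp hxy s).mp (Finset.mem_filter.mpr ⟨hs, h⟩))).2
  have hev : ∀ᶠ δ : ℝ in nhds 0, ∀ s ∈ F, ⟪x + δ • (x - y), s⟫ ≤ 1 := by
    rw [Filter.eventually_all_finset]
    intro s hs
    rcases (hx.1 s hs).eq_or_lt with h | h
    · refine Filter.Eventually.of_forall fun δ => ?_
      rw [inner_add_left, real_inner_smul_left, inner_sub_left, h, hactive s hs h]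
      simp
    · have hc : Continuous fun δ : ℝ => ⟪x + δ • (x - y), s⟫ := by fun_prop
      have := hc.tendsto 0
      simp only [zero_smul, add_zero] at this
      exact (this.eventually_lt_const h).mono fun _ => le_of_lt
  obtain ⟨δ, hδF, hδ⟩ :=
    ((hev.filter_mono nhdsWithin_le_nhds).and (self_mem_nhdsWithin (s := Set.Ioi (0 : ℝ)))).exists
  have hδ0 : 0 < δ := hδ
  refine (hx.2 hy.1 (x₂ := x + δ • (x - y)) hδF ?_).symm
  refine ⟨δ / (1 + δ), 1 / (1 + δ), by positivity, by positivity, by field_simp; ring, ?_⟩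
  have h1 : (1 + δ) ≠ 0 := by positivity
  have h2 : (1 + δ)⁻¹ + (1 + δ)⁻¹ * δ = 1 := by field_simp
  calc (δ / (1 + δ)) • y + (1 / (1 + δ)) • (x + δ • (x - y))
      = ((1 + δ)⁻¹ + (1 + δ)⁻¹ * δ) • x := by
        simp only [div_eq_mul_inv]
        module
    _ = x := by rw [h2, one_smul]

theorem mem_of_forall_extremePoints_polarSet {S : Set 𝔼} (hS : Convex ℝ S) (hcl : IsClosed S)
    (h0 : 0 ∈ interior S) {x : 𝔼}
    (hx : ∀ a ∈ Set.extremePoints ℝ (polarSet S), ⟪a, x⟫ ≤ 1) : x ∈ S := by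
  by_contra hxS
  obtain ⟨f, u, hf, hu⟩ := geometric_hahn_banach_closed_point hS hcl hxS
  have hu0 : 0 < u := by simpa using hf 0 (interior_subset h0)
  set a : 𝔼 := (InnerProductSpace.toDual ℝ 𝔼).symm f with ha
  have hfa : ∀ y, ⟪a, y⟫ = f y := fun y => by simp [ha]
  have hmem : u⁻¹ • a ∈ polarSet S := fun s hs => by
    rw [real_inner_smul_left, hfa, inv_mul_le_iff₀ hu0, mul_one]
    exact (hf s hs).le
  rw [← closure_convexHull_extremePoints (isCompact_polarSet h0) (convex_polarSet S)] at hmem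
  have hconv : Convex ℝ {y : 𝔼 | ⟪y, x⟫ ≤ 1} := by
    simp_rw [real_inner_comm x]
    exact convex_halfSpace_le (innerSL ℝ x).toLinearMap.isLinear 1
  have hclosed : IsClosed {y : 𝔼 | ⟪y, x⟫ ≤ 1} := isClosed_le (by fun_prop) continuous_const
  have h : ⟪u⁻¹ • a, x⟫ ≤ 1 := closure_minimal (convexHull_min hx hconv) hclosed hmem
  rw [real_inner_smul_left, hfa, inv_mul_le_iff₀ hu0, mul_one] at h
  exact absurd hu h.not_gt

/-- At a local maximum of a product of affine functions `1 - ⟪a, x⟫`, all of them positive there,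
the gradient `∑ a, (1 - ⟪a, t⟫)⁻¹ • a` of minus its logarithm vanishes. -/
theorem sum_polarTranslate_eq_zero_of_isLocalMax {E : Finset 𝔼} {t : 𝔼}
    (hpos : ∀ a ∈ E, ⟪a, t⟫ < 1) (hmax : IsLocalMax (fun x : 𝔼 => ∏ a ∈ E, (1 - ⟪a, x⟫)) t) :
    ∑ a ∈ E, polarTranslate t a = 0 := by
  set v := ∑ a ∈ E, polarTranslate t a with hv
  have hev : ∀ᶠ x in nhds t, ∀ a ∈ E, 0 < 1 - ⟪a, x⟫ := by
    rw [Filter.eventually_all_finset]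
    intro a ha
    have hc : Continuous fun x : 𝔼 => 1 - ⟪a, x⟫ := by fun_prop
    exact hc.tendsto t |>.eventually_const_lt (sub_pos.mpr (hpos a ha))
  have hlog : IsLocalMax (fun x : 𝔼 => ∑ a ∈ E, Real.log (1 - ⟪a, x⟫)) t := by
    filter_upwards [hmax, hev] with x hx hxpos
    rw [← Real.log_prod (fun a ha => (hxpos a ha).ne'),
      ← Real.log_prod (fun a ha => (sub_pos.mpr (hpos a ha)).ne')]
    exact Real.log_le_log (Finset.prod_pos hxpos) hx
  have hderiv : HasDerivAt (fun δ : ℝ => ∑ a ∈ E, Real.log (1 - ⟪a, t + δ • v⟫))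
      (∑ a ∈ E, -⟪a, v⟫ / (1 - ⟪a, t⟫)) 0 := by
    refine HasDerivAt.fun_sum fun a ha => ?_
    have h : HasDerivAt (fun δ : ℝ => 1 - ⟪a, t + δ • v⟫) (-⟪a, v⟫) 0 := by
      simp only [inner_add_right, inner_smul_right]
      simpa using (((hasDerivAt_id (0 : ℝ)).mul_const ⟪a, v⟫).const_add ⟪a, t⟫).const_sub 1
    simpa using h.log (by simpa using (sub_pos.mpr (hpos a ha)).ne')
  have hline : IsLocalMax (fun δ : ℝ => ∑ a ∈ E, Real.log (1 - ⟪a, t + δ • v⟫)) 0 := by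
    have hc : Continuous fun δ : ℝ => t + δ • v := by fun_prop
    have hlim : Filter.Tendsto (fun δ : ℝ => t + δ • v) (nhds 0) (nhds t) := by
      simpa using hc.tendsto 0
    filter_upwards [hlim.eventually hlog] with δ hδ
    simpa using hδ
  have hzero := hline.hasDerivAt_eq_zero hderiv
  have hinner : ⟪v, v⟫ = 0 := by
    conv_lhs => rw [hv, sum_inner]
    rw [← neg_eq_zero, ← hzero, ← Finset.sum_neg_distrib]
    refine Finset.sum_congr rfl fun a _ => ?_
    rw [polarTranslate, real_inner_smul_left]
    ring
  exact inner_self_eq_zero.mp hinner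

theorem exists_sum_extremePoints_polarSet_eq_zero (F : Finset 𝔼)
    (h0 : 0 ∈ interior (convexHull ℝ (F : Set 𝔼))) :
    ∃ t ∈ interior (convexHull ℝ (F : Set 𝔼)), ∃ V : Finset 𝔼,
      (V : Set 𝔼) = Set.extremePoints ℝ
        (polarSet ((fun x => x - t) '' convexHull ℝ (F : Set 𝔼))) ∧ ∑ v ∈ V, v = 0 := by
  classical
  set S := convexHull ℝ (F : Set 𝔼) with hS
  have hcomp : IsCompact S := F.finite_toSet.isCompact_convexHull ℝ
  have hfin : (Set.extremePoints ℝ (polarSet S)).Finite := by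
    rw [hS, polarSet_convexHull]
    exact finite_extremePoints_polarSet F
  set E := hfin.toFinset with hE
  have hEpolar : ∀ a ∈ E, a ∈ polarSet S := fun a ha => (hfin.mem_toFinset.mp ha).1
  obtain ⟨t, htS, hmax⟩ := hcomp.exists_isMaxOn ⟨0, interior_subset h0⟩
    (f := fun x : 𝔼 => ∏ a ∈ E, (1 - ⟪a, x⟫)) (by fun_prop)
  have hprod : 0 < ∏ a ∈ E, (1 - ⟪a, t⟫) := by
    have h : ∏ a ∈ E, (1 - ⟪a, (0 : 𝔼)⟫) ≤ ∏ a ∈ E, (1 - ⟪a, t⟫) := hmax (interior_subset h0)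
    simp only [inner_zero_right, sub_zero, Finset.prod_const_one] at h
    linarith
  have hpos : ∀ a ∈ E, ⟪a, t⟫ < 1 := fun a ha =>
    lt_of_le_of_ne (hEpolar a ha t htS) fun h =>
      hprod.ne' (Finset.prod_eq_zero ha (by rw [h, sub_self]))
  have ht : t ∈ interior S := by
    have hev : ∀ᶠ x in nhds t, ∀ a ∈ E, ⟪a, x⟫ < 1 := by
      rw [Filter.eventually_all_finset]
      intro a ha
      have hc : Continuous fun x : 𝔼 => ⟪a, x⟫ := by fun_prop
      exact (hc.tendsto t).eventually_lt_const (hpos a ha)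
    rw [mem_interior_iff_mem_nhds]
    filter_upwards [hev] with x hx
    exact mem_of_forall_extremePoints_polarSet (convex_convexHull ℝ _) hcomp.isClosed h0
      fun a ha => (hx a (hfin.mem_toFinset.mpr ha)).le
  refine ⟨t, ht, E.image (polarTranslate t), ?_, ?_⟩
  · rw [Finset.coe_image, hE, hfin.coe_toFinset, polarTranslate_image_extremePoints h0 ht]
  · rw [Finset.sum_image]
    · exact sum_polarTranslate_eq_zero_of_isLocalMax hpos
        (hmax.isLocalMax (mem_interior_iff_mem_nhds.mp ht))
    · intro a ha b hb hab
      rw [← polarTranslate_neg_polarTranslate (hpos a ha), hab,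
        polarTranslate_neg_polarTranslate (hpos b hb)]

end PolarSet

/-- **Polarity trick.** For a convex polytope `P ⊆ ℝ^d` with non-empty interior there is a
point `c` in the interior of `P` such that the (finitely many) extreme points of the polar
polytope `(P - c)°` sum up to zero. -/
theorem polarity_trick_sum_of_vertices (d : ℕ) (F : Finset (EuclideanSpace ℝ (Fin d)))
    (P : Set (EuclideanSpace ℝ (Fin d)))
    (hP : P = convexHull ℝ (F : Set (EuclideanSpace ℝ (Fin d))))
    (hint : (interior P).Nonempty) :
    ∃ c ∈ interior P, ∃ V : Finset (EuclideanSpace ℝ (Fin d)),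
      (V : Set (EuclideanSpace ℝ (Fin d))) =
        Set.extremePoints ℝ (polarSet ((fun x => x - c) '' P)) ∧
      ∑ v ∈ V, v = 0 := by
  classical
  subst hP
  obtain ⟨c₀, hc₀⟩ := hint
  have himage : (fun x => x - c₀) '' convexHull ℝ (F : Set (EuclideanSpace ℝ (Fin d))) =
      convexHull ℝ ((F.image fun x => x - c₀ : Finset (EuclideanSpace ℝ (Fin d))) :
        Set (EuclideanSpace ℝ (Fin d))) := by
    have h := AffineMap.image_convexHull
      (AffineEquiv.constVAdd ℝ (EuclideanSpace ℝ (Fin d)) (-c₀)).toAffineMap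
      (F : Set (EuclideanSpace ℝ (Fin d)))
    simpa [sub_eq_neg_add] using h
  have hinterior := (Homeomorph.subRight c₀).image_interior
    (convexHull ℝ (F : Set (EuclideanSpace ℝ (Fin d))))
  simp only [Homeomorph.coe_subRight, himage] at hinterior
  obtain ⟨t, ht, V, hV, hsum⟩ := exists_sum_extremePoints_polarSet_eq_zero
    (F.image fun x => x - c₀) (hinterior ▸ ⟨c₀, hc₀, sub_self c₀⟩)
  rw [← hinterior] at ht
  obtain ⟨c, hc, rfl⟩ := ht
  refine ⟨c, hc, V, ?_, hsum⟩
  rw [hV, ← himage, Set.image_image]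
  simp only [sub_sub_sub_cancel_right]
end

section
/- Let Q ⊂ ℝ^d be a finite set such that P = {x ∈ ℝ^d : ⟨x, v⟩ ≤ 1 for all v ∈ Q} is a compact polytope containing the origin in its interior. Given positive numbers β_v > 0 for each v ∈ Q, define F : ℝ^d → ℝ by F(x) = Π_{v ∈ Q} (max(1 − ⟨x, v⟩, 0))^{β_v}. Then F attains its maximum over ℝ^d at a unique point c, this point c lies in the interior of P, and it satisfies Σ_{v ∈ Q} β_v · v/(1 − ⟨c, v⟩) = 0. -/
open scoped RealInnerProductSpace

/-- A vector orthogonal to all facet normals of a bounded polytope vanishes. -/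
theorem eq_zero_of_inner_eq_zero_of_isBounded {E : Type*} [NormedAddCommGroup E]
    [InnerProductSpace ℝ E] {Q : Finset E}
    (hb : Bornology.IsBounded {x : E | ∀ v ∈ Q, ⟪x, v⟫ ≤ 1}) {w : E}
    (hw : ∀ v ∈ Q, ⟪w, v⟫ = 0) : w = 0 := by
  by_contra hne
  obtain ⟨R, hR⟩ := hb.exists_norm_le
  have hpos : 0 < ‖w‖ := norm_pos_iff.mpr hne
  have h := hR (((|R| + 1) / ‖w‖) • w) (fun v hv => by simp [inner_smul_left, hw v hv])
  rw [norm_smul, Real.norm_of_nonneg (by positivity), div_mul_cancel₀ _ hpos.ne'] at h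
  linarith [le_abs_self R]

/-- The weighted sum of normals vanishes at a local maximum of the logarithmic barrier. -/
theorem sum_div_smul_eq_zero_of_isLocalMax {E : Type*} [NormedAddCommGroup E]
    [InnerProductSpace ℝ E] {Q : Finset E} {β : E → ℝ} {c : E}
    (hc : ∀ v ∈ Q, 0 < 1 - ⟪c, v⟫)
    (hmax : IsLocalMax (fun y : E => ∑ v ∈ Q, β v * Real.log (1 - ⟪y, v⟫)) c) :
    (∑ v ∈ Q, (β v / (1 - ⟪c, v⟫)) • v) = 0 := by
  set s := ∑ v ∈ Q, (β v / (1 - ⟪c, v⟫)) • v with hs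
  have hline : Filter.Tendsto (fun t : ℝ => c + t • s) (nhds 0) (nhds c) := by
    have : Continuous fun t : ℝ => c + t • s := by fun_prop
    simpa using this.tendsto 0
  have hloc : IsLocalMax (fun t : ℝ => ∑ v ∈ Q, β v * Real.log (1 - ⟪c + t • s, v⟫)) 0 := by
    filter_upwards [hline.eventually hmax] with t ht
    simpa using ht
  have hder : HasDerivAt (fun t : ℝ => ∑ v ∈ Q, β v * Real.log (1 - ⟪c + t • s, v⟫))
      (∑ v ∈ Q, β v * (-⟪s, v⟫ / (1 - ⟪c, v⟫))) 0 := by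
    refine HasDerivAt.fun_sum fun v hv => HasDerivAt.const_mul _ ?_
    have hlin : HasDerivAt (fun t : ℝ => 1 - ⟪c + t • s, v⟫) (-⟪s, v⟫) 0 := by
      have h := (((hasDerivAt_id (0 : ℝ)).mul_const ⟪s, v⟫).const_add ⟪c, v⟫).const_sub 1
      simpa [inner_add_left, real_inner_smul_left] using h
    simpa using hlin.log (by simpa using (hc v hv).ne')
  have hzero := hloc.hasDerivAt_eq_zero hder
  have hinner : ⟪s, s⟫ = -∑ v ∈ Q, β v * (-⟪s, v⟫ / (1 - ⟪c, v⟫)) := by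
    nth_rewrite 2 [hs]
    rw [inner_sum]
    rw [← Finset.sum_neg_distrib]
    refine Finset.sum_congr rfl fun v _ => ?_
    rw [real_inner_smul_right]
    ring
  rw [hzero, neg_zero] at hinner
  exact inner_self_eq_zero.mp hinner

/-- Let `Q ⊂ ℝ^d` be a finite set such that `P = {x : ⟪x, v⟫ ≤ 1 ∀ v ∈ Q}` is a compact
polytope containing the origin in its interior, and let `β v > 0` for `v ∈ Q`. Then the
function `F x = ∏_{v ∈ Q} (max (1 - ⟪x, v⟫) 0) ^ (β v)` attains its maximum over `ℝ^d` at a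
unique point `c`, which lies in the interior of `P` and satisfies
`∑_{v ∈ Q} (β v / (1 - ⟪c, v⟫)) • v = 0`. -/
theorem max_of_product_functional (d : ℕ) (Q : Finset (EuclideanSpace ℝ (Fin d)))
    (P : Set (EuclideanSpace ℝ (Fin d)))
    (hPdef : P = {x : EuclideanSpace ℝ (Fin d) | ∀ v ∈ Q, ⟪x, v⟫ ≤ 1})
    (hPcompact : IsCompact P)
    (h0 : (0 : EuclideanSpace ℝ (Fin d)) ∈ interior P)
    (β : EuclideanSpace ℝ (Fin d) → ℝ) (hβ : ∀ v ∈ Q, 0 < β v)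
    (F : EuclideanSpace ℝ (Fin d) → ℝ)
    (hF : ∀ x, F x = ∏ v ∈ Q, (max (1 - ⟪x, v⟫) 0) ^ (β v)) :
    ∃ c : EuclideanSpace ℝ (Fin d),
      (∀ x, F x ≤ F c) ∧
      (∀ x, (∀ y, F y ≤ F x) → x = c) ∧
      c ∈ interior P ∧
      (∑ v ∈ Q, (β v / (1 - ⟪c, v⟫)) • v) = 0 := by
  have hmem : ∀ x, x ∈ P ↔ ∀ v ∈ Q, ⟪x, v⟫ ≤ 1 := fun x => by rw [hPdef]; rfl
  have hnonneg : ∀ x, 0 ≤ F x := fun x => by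
    rw [hF]
    exact Finset.prod_nonneg fun v _ => Real.rpow_nonneg (le_max_right _ _) _
  have hpos : ∀ x, 0 < F x → ∀ v ∈ Q, 0 < 1 - ⟪x, v⟫ := by
    intro x hx v hv
    by_contra! h
    rw [hF, Finset.prod_eq_zero hv (by rw [max_eq_right h, Real.zero_rpow (hβ v hv).ne'])] at hx
    exact hx.false
  have hF' : ∀ x, (∀ v ∈ Q, 0 < 1 - ⟪x, v⟫) → F x = ∏ v ∈ Q, (1 - ⟪x, v⟫) ^ (β v) := by
    intro x hx
    rw [hF]
    exact Finset.prod_congr rfl fun v hv => by rw [max_eq_left (hx v hv).le]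
  have hcont : Continuous F := by
    rw [funext hF]
    refine continuous_finsetProd _ fun v hv => ?_
    exact Continuous.rpow_const (by fun_prop) fun _ => Or.inr (hβ v hv).le
  obtain ⟨c, -, hcmax⟩ := hPcompact.exists_isMaxOn ⟨0, interior_subset h0⟩ hcont.continuousOn
  have hmax : ∀ x, F x ≤ F c := by
    intro x
    by_cases hx : x ∈ P
    · exact hcmax hx
    · have : ¬ 0 < F x := fun h => hx ((hmem x).2 fun v hv => by linarith [hpos x h v hv])
      exact (not_lt.mp this).trans (hnonneg c)
  have hFc : 0 < F c := lt_of_lt_of_le (by simp [hF]) (hmax 0)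
  have hc := hpos c hFc
  have hnear : ∀ᶠ y in nhds c, ∀ v ∈ Q, 0 < 1 - ⟪y, v⟫ := by
    rw [Filter.eventually_all_finset]
    intro v hv
    have : Continuous fun y : EuclideanSpace ℝ (Fin d) => 1 - ⟪y, v⟫ := by fun_prop
    exact this.continuousAt.eventually_const_lt (hc v hv)
  refine ⟨c, hmax, ?_, ?_, ?_⟩
  · intro x hx
    have hFx : F x = F c := le_antisymm (hmax x) (hx c)
    have hxp := hpos x (hFx ▸ hFc)
    refine sub_eq_zero.mp (eq_zero_of_inner_eq_zero_of_isBounded (hPdef ▸ hPcompact.isBounded) ?_)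
    by_contra! hne
    obtain ⟨u, hu, hune⟩ := hne
    rw [inner_sub_left] at hune
    have hmid : ∀ v, 1 - ⟪(1 / 2 : ℝ) • (x + c), v⟫ = ((1 - ⟪x, v⟫) + (1 - ⟪c, v⟫)) / 2 := by
      intro v
      rw [real_inner_smul_left, inner_add_left]
      ring
    have hmp : ∀ v ∈ Q, 0 < 1 - ⟪(1 / 2 : ℝ) • (x + c), v⟫ := fun v hv => by
      rw [hmid]
      linarith [hxp v hv, hc v hv]
    have hlt : F x * F c < F ((1 / 2 : ℝ) • (x + c)) * F ((1 / 2 : ℝ) • (x + c)) := by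
      rw [hF' x hxp, hF' c hc, hF' _ hmp, ← Finset.prod_mul_distrib, ← Finset.prod_mul_distrib]
      refine Finset.prod_lt_prod (fun v hv => mul_pos (Real.rpow_pos_of_pos (hxp v hv) _)
        (Real.rpow_pos_of_pos (hc v hv) _)) (fun v hv => ?_) ⟨u, hu, ?_⟩
      · rw [← Real.mul_rpow (hxp v hv).le (hc v hv).le,
          ← Real.mul_rpow (hmp v hv).le (hmp v hv).le, hmid]
        refine Real.rpow_le_rpow (mul_pos (hxp v hv) (hc v hv)).le ?_ (hβ v hv).le
        nlinarith [sq_nonneg (⟪x, v⟫ - ⟪c, v⟫)]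
      · rw [← Real.mul_rpow (hxp u hu).le (hc u hu).le,
          ← Real.mul_rpow (hmp u hu).le (hmp u hu).le, hmid]
        refine Real.rpow_lt_rpow (mul_pos (hxp u hu) (hc u hu)).le ?_ (hβ u hu)
        nlinarith [sq_pos_of_ne_zero hune]
    rw [hFx] at hlt
    exact hlt.not_ge (mul_self_le_mul_self (hnonneg _) (hmax _))
  · rw [mem_interior_iff_mem_nhds]
    filter_upwards [hnear] with y hy
    exact (hmem y).2 fun v hv => by linarith [hy v hv]
  · refine sum_div_smul_eq_zero_of_isLocalMax hc ?_
    have hlog : ∀ y, (∀ v ∈ Q, 0 < 1 - ⟪y, v⟫) →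
        ∑ v ∈ Q, β v * Real.log (1 - ⟪y, v⟫) = Real.log (F y) := by
      intro y hy
      rw [hF' y hy, Real.log_prod fun v hv => (Real.rpow_pos_of_pos (hy v hv) _).ne']
      exact Finset.sum_congr rfl fun v hv => (Real.log_rpow (hy v hv) _).symm
    filter_upwards [hnear] with y hy
    rw [hlog y hy, hlog c hc]
    refine Real.log_le_log ?_ (hmax y)
    rw [hF' y hy]
    exact Finset.prod_pos fun v hv => Real.rpow_pos_of_pos (hy v hv) _
end

section
/- Let L be a bounded subset of ℝ^d that linearly spans ℝ^d. Suppose v₁, …, v_d ∈ L are such that the simplex S = conv{0, v₁, …, v_d} has maximal d-dimensional volume among all simplices conv{0, u₁, …, u_d} with u₁, …, u_d ∈ L. Let P denote the Minkowski sum of the segments [−v₁, v₁], …, [−v_d, v_d]. Then L ⊆ P ⊆ −2d·S + (v₁ + ⋯ + v_d). -/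
open scoped Pointwise
open MeasureTheory

theorem volume_convexHull_insert_zero_range {d : ℕ} (u : Fin d → EuclideanSpace ℝ (Fin d)) :
    volume (convexHull ℝ (insert (0 : EuclideanSpace ℝ (Fin d)) (Set.range u))) =
      ENNReal.ofReal |(EuclideanSpace.basisFun (Fin d) ℝ).toBasis.det u| *
        volume (convexHull ℝ (insert (0 : EuclideanSpace ℝ (Fin d))
          (Set.range (EuclideanSpace.basisFun (Fin d) ℝ).toBasis))) := by
  set b := (EuclideanSpace.basisFun (Fin d) ℝ).toBasis
  set f := b.constr ℝ u with hf
  have hfb : f ∘ b = u := by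
    ext1 i
    simp [hf]
  have hdet : LinearMap.det f = b.det u := by
    have h := b.det_comp f b
    rw [hfb, b.det_self, mul_one] at h
    exact h.symm
  rw [← hdet, ← Measure.addHaar_image_linearMap, LinearMap.image_convexHull,
    Set.image_insert_eq, map_zero, ← Set.range_comp, hfb]

theorem volume_convexHull_insert_zero_basis_pos {d : ℕ}
    (b : Module.Basis (Fin d) ℝ (EuclideanSpace ℝ (Fin d))) :
    0 < volume (convexHull ℝ (insert (0 : EuclideanSpace ℝ (Fin d)) (Set.range b))) := by
  refine Measure.measure_pos_of_nonempty_interior _ ?_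
  rw [interior_convexHull_nonempty_iff_affineSpan_eq_top,
    AffineSubspace.affineSpan_eq_top_iff_vectorSpan_eq_top_of_nonempty _ _ _
      (Set.insert_nonempty _ _),
    vectorSpan_eq_span_vsub_set_right ℝ (Set.mem_insert _ _), eq_top_iff, ← b.span_eq]
  exact Submodule.span_mono fun x hx => ⟨x, Set.mem_insert_of_mem _ hx, by simp⟩

theorem volume_convexHull_insert_zero_range_lt_top {d : ℕ}
    (u : Fin d → EuclideanSpace ℝ (Fin d)) :
    volume (convexHull ℝ (insert (0 : EuclideanSpace ℝ (Fin d)) (Set.range u))) < ⊤ :=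
  (((Set.finite_range u).insert 0).isCompact_convexHull ℝ).measure_lt_top

theorem exists_basis_mem_of_span_eq_top {d : ℕ} {L : Set (EuclideanSpace ℝ (Fin d))}
    (hL : Submodule.span ℝ L = ⊤) :
    ∃ b : Module.Basis (Fin d) ℝ (EuclideanSpace ℝ (Fin d)), ∀ i, b i ∈ L := by
  let c := Module.Basis.ofSpan hL.ge
  have e := c.indexEquiv (EuclideanSpace.basisFun (Fin d) ℝ).toBasis
  refine ⟨c.reindex e, fun i => ?_⟩
  rw [Module.Basis.reindex_apply]
  exact Module.Basis.ofSpan_subset hL.ge (Set.mem_range_self _)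

theorem mem_sum_segment_neg_self_iff {ι E : Type*} [Fintype ι] [AddCommGroup E] [Module ℝ E]
    (v : ι → E) (x : E) :
    x ∈ ∑ i, segment ℝ (-(v i)) (v i) ↔
      ∃ c : ι → ℝ, (∀ i, |c i| ≤ 1) ∧ ∑ i, c i • v i = x := by
  have hseg (y z : E) : z ∈ segment ℝ (-y) y ↔ ∃ t : ℝ, |t| ≤ 1 ∧ t • y = z := by
    constructor
    · rintro ⟨a, b, ha, hb, hab, rfl⟩
      exact ⟨b - a, abs_le.2 ⟨by linarith, by linarith⟩, by module⟩
    · rintro ⟨t, ht, rfl⟩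
      obtain ⟨h₁, h₂⟩ := abs_le.1 ht
      exact ⟨(1 - t) / 2, (1 + t) / 2, by linarith, by linarith, by ring, by module⟩
  rw [Set.mem_fintype_sum]
  constructor
  · rintro ⟨g, hg, rfl⟩
    choose c hc hcg using fun i => (hseg (v i) (g i)).1 (hg i)
    exact ⟨c, hc, by simp only [hcg]⟩
  · rintro ⟨c, hc, rfl⟩
    exact ⟨fun i => c i • v i, fun i => (hseg _ _).2 ⟨c i, hc i, rfl⟩, rfl⟩

theorem sum_smul_mem_convexHull_insert_zero {ι E : Type*} [Fintype ι] [AddCommGroup E]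
    [Module ℝ E] (v : ι → E) (w : ι → ℝ) (hw : ∀ i, 0 ≤ w i) (hw₁ : ∑ i, w i ≤ 1) :
    ∑ i, w i • v i ∈ convexHull ℝ (insert 0 (Set.range v)) := by
  have h := (convex_convexHull ℝ (insert 0 (Set.range v))).sum_mem
    (t := (Finset.univ : Finset (Option ι)))
    (w := fun o => o.elim (1 - ∑ i, w i) w) (z := fun o => o.elim 0 v)
    (by rintro (_ | i) -
        · simpa using hw₁
        · exact hw i)
    (by simp [Fintype.sum_option])
    (by rintro (_ | i) -
        · exact subset_convexHull ℝ _ (Set.mem_insert _ _)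
        · exact subset_convexHull ℝ _ (Set.mem_insert_of_mem _ (Set.mem_range_self i)))
  simpa [Fintype.sum_option] using h

/-- **Maximal volume simplex inclusions.** Let `L` be a bounded subset of `ℝ^d` linearly
spanning the whole space and let `S = conv{0, v₁, …, v_d}` be a simplex of maximal volume
among all simplices with `d` vertices in `L` and one vertex at the origin. If `P` is the
Minkowski sum of the segments `[-vᵢ, vᵢ]`, then `L ⊆ P ⊆ -2d·S + (v₁ + ⋯ + v_d)`. -/
theorem max_volume_simplex_inclusions (d : ℕ) (L : Set (EuclideanSpace ℝ (Fin d)))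
    (hLbdd : Bornology.IsBounded L)
    (hLspan : Submodule.span ℝ L = ⊤)
    (v : Fin d → EuclideanSpace ℝ (Fin d)) (hv : ∀ i, v i ∈ L)
    (S : Set (EuclideanSpace ℝ (Fin d)))
    (hS : S = convexHull ℝ (insert (0 : EuclideanSpace ℝ (Fin d)) (Set.range v)))
    (hmax : ∀ u : Fin d → EuclideanSpace ℝ (Fin d), (∀ i, u i ∈ L) →
      volume (convexHull ℝ (insert (0 : EuclideanSpace ℝ (Fin d)) (Set.range u))) ≤ volume S)
    (P : Set (EuclideanSpace ℝ (Fin d)))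
    (hPdef : P = ∑ i : Fin d, segment ℝ (-(v i)) (v i)) :
    L ⊆ P ∧ P ⊆ (-(2 * (d : ℝ))) • S + {∑ i : Fin d, v i} := by
  subst hS hPdef
  constructor
  · set b := (EuclideanSpace.basisFun (Fin d) ℝ).toBasis with hb
    have hle (u : Fin d → EuclideanSpace ℝ (Fin d)) (hu : ∀ i, u i ∈ L) :
        |b.det u| ≤ |b.det v| := by
      have h := hmax u hu
      rw [volume_convexHull_insert_zero_range u, volume_convexHull_insert_zero_range v,
        ENNReal.mul_le_mul_iff_left (volume_convexHull_insert_zero_basis_pos _).ne'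
          (volume_convexHull_insert_zero_range_lt_top _).ne] at h
      exact (ENNReal.ofReal_le_ofReal_iff (abs_nonneg _)).1 h
    obtain ⟨c, hc⟩ := exists_basis_mem_of_span_eq_top hLspan
    have hpos : 0 < |b.det v| := (abs_pos.2 (b.isUnit_det c).ne_zero).trans_le (hle c hc)
    obtain ⟨hli, hsp⟩ := (Module.Basis.is_basis_iff_det b).2 (abs_pos.1 hpos).isUnit
    intro x hx
    refine (mem_sum_segment_neg_self_iff v x).2
      ⟨(Module.Basis.mk hli hsp.ge).repr x, fun i => ?_, ?_⟩
    · have h := congrArg (fun f => f x) (b.det_smul_mk_coord_eq_det_update hli hsp.ge i)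
      simp only [LinearMap.smul_apply, Module.Basis.coord_apply, smul_eq_mul,
        MultilinearMap.toLinearMap_apply, AlternatingMap.coe_multilinearMap] at h
      have hu := hle (Function.update v i x) fun j => by
        rcases eq_or_ne j i with rfl | hj
        · simpa using hx
        · simpa [hj] using hv j
      rw [← h, abs_mul] at hu
      exact le_of_mul_le_mul_left (by simpa using hu) hpos
    · simpa using (Module.Basis.mk hli hsp.ge).sum_repr x
  · intro x hx
    obtain ⟨c, hc, rfl⟩ := (mem_sum_segment_neg_self_iff v x).1 hx
    rcases Nat.eq_zero_or_pos d with rfl | hd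
    · simp
    have hd' : (0 : ℝ) < d := Nat.cast_pos.2 hd
    refine Set.mem_add.2 ⟨_, Set.smul_mem_smul_set (sum_smul_mem_convexHull_insert_zero v
      (fun i => (1 - c i) / (2 * d)) (fun i => ?_) ?_), _, Set.mem_singleton _, ?_⟩
    · have := (abs_le.1 (hc i)).2
      exact div_nonneg (by linarith) (by positivity)
    · calc ∑ i, (1 - c i) / (2 * (d : ℝ)) ≤ ∑ _i : Fin d, 1 / (d : ℝ) := by
            refine Finset.sum_le_sum fun i _ => ?_
            have := (abs_le.1 (hc i)).1
            rw [div_le_div_iff₀ (by positivity) hd']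
            nlinarith
        _ = 1 := by simp [hd'.ne']
    · rw [Finset.smul_sum, ← Finset.sum_add_distrib]
      refine Finset.sum_congr rfl fun i _ => ?_
      rw [smul_smul]
      have : -(2 * (d : ℝ)) * ((1 - c i) / (2 * d)) = c i - 1 := by
        field_simp
        ring
      rw [this]
      module
end

section
/- Let b ∈ ℝ^d and let p be a point belonging to the convex hull of a set Q ⊂ ℝ^d. Then there exist points v₁, …, v_d ∈ Q (not necessarily distinct) such that p ∈ conv{b, v₁, …, v_d}. -/
/-- If `p` is a convex combination of the points `z i`, and `b` is an affine combination of
them, then one of the `z i` may be replaced by `b` while keeping `p` in the convex hull. -/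
theorem exists_sum_smul_mem_convexHull_range_update {ι E : Type*} [Fintype ι] [DecidableEq ι]
    [AddCommGroup E] [Module ℝ E] {z : ι → E} {w β : ι → ℝ} (hw : ∀ i, 0 ≤ w i)
    (hw1 : ∑ i, w i = 1) (hβ1 : ∑ i, β i = 1) :
    ∃ j, ∑ i, w i • z i ∈
      convexHull ℝ (Set.range (Function.update z j (∑ i, β i • z i))) := by
  obtain ⟨i₁, -, hi₁⟩ : ∃ i ∈ Finset.univ, 0 < β i :=
    Finset.exists_lt_of_sum_lt (f := fun _ => (0 : ℝ)) (by simp [hβ1])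
  obtain ⟨j, hj, hmin⟩ := Finset.exists_min_image {i | 0 < β i} (fun i => w i / β i)
    ⟨i₁, by simpa using hi₁⟩
  simp only [Finset.mem_filter, Finset.mem_univ, true_and] at hj hmin
  set b := ∑ i, β i • z i with hb
  set c := w j / β j with hc
  have hc0 : 0 ≤ c := div_nonneg (hw j) hj.le
  have hcj : w j - c * β j = 0 := by rw [hc]; field_simp; simp
  have hk (i : ι) : 0 ≤ w i - c * β i := by
    rcases lt_or_ge 0 (β i) with hi | hi
    · exact sub_nonneg.2 ((le_div_iff₀ hi).1 (hmin i hi))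
    · linarith [hw i, mul_nonpos_of_nonneg_of_nonpos hc0 hi]
  refine ⟨j, ?_⟩
  have hsum : ∑ i, w i • z i =
      ∑ i, (w i - c * β i + if i = j then c else 0) • Function.update z j b i := by
    have hterm (i : ι) : (w i - c * β i + if i = j then c else 0) • Function.update z j b i =
        (w i • z i - c • β i • z i) + if i = j then c • b else 0 := by
      rw [smul_smul, ← sub_smul]
      rcases eq_or_ne i j with rfl | hij
      · simp [hcj]
      · simp [hij]
    simp_rw [hterm, Finset.sum_add_distrib, Finset.sum_sub_distrib, ← Finset.smul_sum, ← hb]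
    simp
  rw [hsum]
  refine (convex_convexHull ℝ _).sum_mem (fun i _ => ?_) ?_
    (fun i _ => subset_convexHull ℝ _ (Set.mem_range_self i))
  · split_ifs <;> linarith [hk i]
  · simp [Finset.sum_add_distrib, Finset.sum_sub_distrib, ← Finset.mul_sum, hw1, hβ1]

/-- A finite set with at most `d` elements inside a nonempty set `Q` is covered by
the range of a family in `Q` indexed by `Fin d`. -/
theorem Finset.exists_fin_subset_range {α : Type*} {Q : Set α} (hQ : Q.Nonempty) {t : Finset α}
    (ht : ↑t ⊆ Q) {d : ℕ} (hd : t.card ≤ d) :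
    ∃ v : Fin d → α, (∀ i, v i ∈ Q) ∧ (t : Set α) ⊆ Set.range v := by
  obtain ⟨q, hq⟩ := hQ
  obtain ⟨e⟩ : Nonempty (t ↪ Fin d) := Function.Embedding.nonempty_of_card_le (by simpa using hd)
  refine ⟨Function.extend e Subtype.val fun _ => q, fun i => ?_, fun x hx => ⟨e ⟨x, hx⟩, ?_⟩⟩
  · by_cases hi : ∃ a, e a = i
    · obtain ⟨a, rfl⟩ := hi
      rw [e.injective.extend_apply]
      exact ht a.2
    · rwa [Function.extend_apply' _ _ _ hi]
  · rw [e.injective.extend_apply]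

/-- **Carathéodory with a prescribed point.** If `b ∈ ℝ^d` and `p` belongs to the convex
hull of a set `Q ⊆ ℝ^d`, then there are points `v₁, …, v_d ∈ Q` (not necessarily distinct)
such that `p ∈ conv{b, v₁, …, v_d}`. -/
theorem caratheodory_minus_point (d : ℕ) (b : EuclideanSpace ℝ (Fin d))
    (Q : Set (EuclideanSpace ℝ (Fin d))) (p : EuclideanSpace ℝ (Fin d))
    (hp : p ∈ convexHull ℝ Q) :
    ∃ v : Fin d → EuclideanSpace ℝ (Fin d), (∀ i, v i ∈ Q) ∧
      p ∈ convexHull ℝ (insert b (Set.range v)) := by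
  classical
  obtain ⟨t, ht, hp'⟩ : ∃ t : Finset (EuclideanSpace ℝ (Fin d)), ↑t ⊆ Q ∧ t.card ≤ d ∧
      p ∈ convexHull ℝ (insert b (t : Set (EuclideanSpace ℝ (Fin d)))) := by
    obtain ⟨ι, _, z, w, hz, hind, hw, hw1, rfl⟩ := eq_pos_convex_span_of_mem_convexHull hp
    have hcard : Fintype.card ι ≤ d + 1 := by
      have := hind.card_le_finrank_succ
      have := Submodule.finrank_le (vectorSpan ℝ (Set.range z))
      simp only [finrank_euclideanSpace_fin] at this
      omega
    rcases hcard.lt_or_eq with hlt | heq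
    · refine ⟨Finset.univ.image z, by simpa using hz,
        Finset.card_image_le.trans (Nat.lt_succ_iff.1 hlt), ?_⟩
      refine (convex_convexHull ℝ _).sum_mem (fun i _ => (hw i).le) hw1
        (fun i _ => subset_convexHull ℝ _ (by simp))
    · have hb : b ∈ affineSpan ℝ (Set.range z) := by
        rw [hind.affineSpan_eq_top_iff_card_eq_finrank_add_one.2 (by simpa using heq)]
        trivial
      obtain ⟨β, hβ1, hβ⟩ := eq_affineCombination_of_mem_affineSpan_of_fintype hb
      rw [Finset.affineCombination_eq_linear_combination _ _ _ hβ1] at hβ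
      obtain ⟨j, hj⟩ := exists_sum_smul_mem_convexHull_range_update (z := z)
        (fun i => (hw i).le) hw1 hβ1
      refine ⟨(Finset.univ.erase j).image z, ?_, Finset.card_image_le.trans ?_,
        convexHull_mono ?_ hj⟩
      · rw [Finset.coe_image]
        exact (Set.image_subset_range _ _).trans hz
      · simp [Finset.card_erase_of_mem, heq]
      · rw [← hβ]
        rintro _ ⟨i, rfl⟩
        rcases eq_or_ne i j with rfl | hij
        · simp
        · rw [Function.update_of_ne hij]
          exact Or.inr (by simpa using ⟨i, hij, rfl⟩)
  obtain ⟨v, hv, htv⟩ :=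
    Finset.exists_fin_subset_range (convexHull_nonempty_iff.1 ⟨p, hp⟩) ht hp'.1
  exact ⟨v, hv, convexHull_mono (Set.insert_subset_insert htv) hp'.2⟩
end

section
/- Let d ≥ 2 and let e₁, …, e_d be the standard basis of ℝ^d. Define p₋ = −√d·(e_d + e₁ + ⋯ + e_{d−1}) and p₊ = −√d·(e_d − e₁ − ⋯ − e_{d−1}), and set Q = {√d·e₁, −√d·e₁, …, √d·e_{d−1}, −√d·e_{d−1}, √d·e_d, p₋, p₊}. Then Q consists of 2d+1 points and conv(Q) contains the closed Euclidean unit ball B^d. -/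
open Metric

/-- A convex set containing the points `±√d • eᵢ` contains the closed Euclidean unit ball. -/
theorem Convex.closedBall_subset_of_sqrt_card_smul_single_mem {d : ℕ}
    {C : Set (EuclideanSpace ℝ (Fin d))} (hC : Convex ℝ C) (h0 : 0 ∈ C)
    (hpos : ∀ i, Real.sqrt d • EuclideanSpace.single i (1 : ℝ) ∈ C)
    (hneg : ∀ i, -(Real.sqrt d • EuclideanSpace.single i (1 : ℝ)) ∈ C) :
    closedBall (0 : EuclideanSpace ℝ (Fin d)) 1 ⊆ C := by
  intro x hx
  rw [mem_closedBall_zero_iff] at hx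
  rcases Nat.eq_zero_or_pos d with rfl | hd
  · rwa [Subsingleton.elim x 0]
  have hs : 0 < Real.sqrt d := Real.sqrt_pos.2 (by exact_mod_cast hd)
  have hsum : ∑ i, |x i| ≤ Real.sqrt d := by
    apply Real.le_sqrt_of_sq_le
    have h1 := sq_sum_le_card_mul_sum_sq (s := Finset.univ) (f := fun i => |x i|)
    have h2 : ∑ i, |x i| ^ 2 ≤ 1 := by
      have h3 := EuclideanSpace.norm_sq_eq x
      simp only [Real.norm_eq_abs] at h3
      rw [← h3]
      exact pow_le_one₀ (norm_nonneg x) hx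
    have h4 : (0 : ℝ) ≤ d := Nat.cast_nonneg d
    simp only [Finset.card_univ, Fintype.card_fin] at h1
    nlinarith
  let w : Option (Fin d) → ℝ := fun o =>
    o.elim (1 - ∑ i, |x i| / Real.sqrt d) fun i => |x i| / Real.sqrt d
  let z : Option (Fin d) → EuclideanSpace ℝ (Fin d) := fun o =>
    o.elim 0 fun i => if 0 ≤ x i then Real.sqrt d • EuclideanSpace.single i (1 : ℝ)
      else -(Real.sqrt d • EuclideanSpace.single i (1 : ℝ))
  have hterm : ∀ i, w (some i) • z (some i) = EuclideanSpace.single i (x i) := by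
    intro i
    ext j
    by_cases hi : 0 ≤ x i
    · by_cases hj : j = i <;> simp [w, z, hi, hj, abs_of_nonneg, hs.ne']
    · by_cases hj : j = i <;> simp [w, z, hi, hj, abs_of_neg (not_le.1 hi), hs.ne']
  have hx_eq : ∑ o, w o • z o = x := by
    rw [Fintype.sum_option]
    simp only [hterm]
    ext j
    simp [z, Finset.sum_apply, Pi.single_apply]
  rw [← hx_eq]
  refine hC.sum_mem ?_ ?_ ?_
  · rintro (_ | i) -
    · simp only [w, Option.elim, ← Finset.sum_div, sub_nonneg]
      exact (div_le_one hs).2 hsum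
    · exact div_nonneg (abs_nonneg _) hs.le
  · simp [w, Fintype.sum_option]
  · rintro (_ | i) -
    · exact h0
    · by_cases hi : 0 ≤ x i
      · simpa [z, hi] using hpos i
      · simpa [z, hi] using hneg i

/-- **Grundbacher's example, part 1.** For `d ≥ 2`, the set
`Q = {±√d·e₁, …, ±√d·e_{d−1}, √d·e_d, p₋, p₊}` with
`p₋ = −√d(e_d + e₁ + ⋯ + e_{d−1})` and `p₊ = −√d(e_d − e₁ − ⋯ − e_{d−1})`
consists of `2d + 1` points and its convex hull contains the closed unit ball. -/
theorem grundbacher_example_contains_ball (d : ℕ) (hd : 2 ≤ d)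
    (e : Fin d → EuclideanSpace ℝ (Fin d))
    (he : ∀ i, e i = EuclideanSpace.single i 1)
    (last : Fin d) (hlast : (last : ℕ) = d - 1)
    (pminus pplus : EuclideanSpace ℝ (Fin d))
    (hpminus : pminus = (-(Real.sqrt d)) • (e last + ∑ i ∈ Finset.univ.erase last, e i))
    (hpplus : pplus = (-(Real.sqrt d)) • (e last - ∑ i ∈ Finset.univ.erase last, e i))
    (Q : Set (EuclideanSpace ℝ (Fin d)))
    (hQ : Q = (⋃ i ∈ {i : Fin d | i ≠ last},
        ({Real.sqrt d • e i, -(Real.sqrt d • e i)} : Set (EuclideanSpace ℝ (Fin d)))) ∪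
        {Real.sqrt d • e last, pminus, pplus}) :
    Q.ncard = 2 * d + 1 ∧
      closedBall (0 : EuclideanSpace ℝ (Fin d)) 1 ⊆ convexHull ℝ Q := by
  have hs : 0 < Real.sqrt d := Real.sqrt_pos.2 (by exact_mod_cast (by omega : 0 < d))
  obtain ⟨k, hk⟩ : ∃ k : Fin d, k ≠ last :=
    ⟨⟨0, by omega⟩, fun h => by have := congrArg Fin.val h; simp at this; omega⟩
  have hecoord : ∀ i j, e i j = if j = i then 1 else 0 := by
    intro i j
    simp [he]
  have hsum : ∀ j, (∑ i ∈ Finset.univ.erase last, e i) j = if j = last then 0 else 1 := by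
    intro j
    by_cases hj : j = last <;> simp [hecoord, hj]
  have hminus : ∀ j, pminus j = -Real.sqrt d := by
    intro j
    rw [hpminus]
    simp only [PiLp.smul_apply, PiLp.add_apply, hsum, hecoord, smul_eq_mul]
    split_ifs <;> ring
  have hplus : ∀ j, pplus j = if j = last then -Real.sqrt d else Real.sqrt d := by
    intro j
    rw [hpplus]
    simp only [PiLp.smul_apply, PiLp.sub_apply, hsum, hecoord, smul_eq_mul]
    split_ifs <;> ring
  constructor
  · let f : Option (Fin d × Bool) → EuclideanSpace ℝ (Fin d) := fun o =>
      o.elim pminus fun p => if p.2 then Real.sqrt d • e p.1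
        else if p.1 = last then pplus else -(Real.sqrt d • e p.1)
    have hrange : Q = Set.range f := by
      rw [hQ]
      ext y
      simp only [Set.mem_union, Set.mem_iUnion, Set.mem_insert_iff, Set.mem_singleton_iff,
        Set.mem_ofPred_eq, Set.mem_range, Option.exists, Prod.exists, Bool.exists_bool, f,
        Option.elim]
      grind
    have hinj : Function.Injective f := by
      have hne : ∀ i b, pminus ≠ f (some (i, b)) := by
        intro i b h
        have h1 := congrArg (fun v => v i) h
        have h2 := congrArg (fun v => v last) h
        have h3 := congrArg (fun v => v k) h
        cases b <;> by_cases hi : i = last <;>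
          simp [f, hi, hminus, hplus, hecoord, hk] at h1 h2 h3 <;> grind
      rintro (_ | ⟨i, b⟩) (_ | ⟨j, c⟩) h
      · rfl
      · exact (hne _ _ h).elim
      · exact (hne _ _ h.symm).elim
      · have h1 := congrArg (fun v => v i) h
        have h2 := congrArg (fun v => v j) h
        have h3 := congrArg (fun v => v last) h
        cases b <;> cases c <;> by_cases hi : i = last <;> by_cases hj : j = last <;>
          simp [f, hi, hj, hplus, hecoord] at h1 h2 h3 ⊢ <;> grind
    rw [hrange, ← Nat.card_coe_set_eq, Nat.card_range_of_injective hinj]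
    simp [mul_comm]
  · have hsub := subset_convexHull ℝ Q
    have hconv := convex_convexHull ℝ Q
    have hpos : ∀ i, Real.sqrt d • e i ∈ convexHull ℝ Q := by
      intro i
      apply hsub
      rw [hQ]
      by_cases hi : i = last
      · simp [hi]
      · exact Or.inl (Set.mem_biUnion (x := i) hi (by simp))
    have hneg : ∀ i, -(Real.sqrt d • e i) ∈ convexHull ℝ Q := by
      intro i
      by_cases hi : i = last
      · have hmid : -(Real.sqrt d • e i) = (1 / 2 : ℝ) • pminus + (1 / 2 : ℝ) • pplus := by
          rw [hi, hpminus, hpplus]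
          module
        rw [hmid]
        exact hconv (hsub (by simp [hQ])) (hsub (by simp [hQ])) (by norm_num) (by norm_num)
          (by norm_num)
      · apply hsub
        rw [hQ]
        exact Or.inl (Set.mem_biUnion (x := i) hi (by simp))
    have h0 : (0 : EuclideanSpace ℝ (Fin d)) ∈ convexHull ℝ Q := by
      have hmid : (0 : EuclideanSpace ℝ (Fin d)) =
          (1 / 2 : ℝ) • (Real.sqrt d • e k) + (1 / 2 : ℝ) • -(Real.sqrt d • e k) := by
        module
      rw [hmid]
      exact hconv (hpos k) (hneg k) (by norm_num) (by norm_num) (by norm_num)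
    exact hconv.closedBall_subset_of_sqrt_card_smul_single_mem h0
      (fun i => he i ▸ hpos i) (fun i => he i ▸ hneg i)
end

section
/- Let d ≥ 2 and let e₁, …, e_d be the standard basis of ℝ^d. Define p₋ = −√d·(e_d + e₁ + ⋯ + e_{d−1}) and p₊ = −√d·(e_d − e₁ − ⋯ − e_{d−1}), and set Q = {√d·e₁, −√d·e₁, …, √d·e_{d−1}, −√d·e_{d−1}, √d·e_d, p₋, p₊}. Then for every subset Q' ⊆ Q with at most 2d points and every r > √(d/(d² + d − 1)), the ball r·B^d is not contained in conv(Q'). -/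
open Metric

/-- A functional bounded by `c` on `S` bounds the radius of any centred ball inside `conv S`. -/
lemma not_closedBall_subset_convexHull_of_inner_le {E : Type*} [NormedAddCommGroup E]
    [InnerProductSpace ℝ E] {S : Set E} {u : E} {c r : ℝ} (hr : 0 ≤ r)
    (hS : ∀ x ∈ S, inner ℝ x u ≤ c) (hc : c < r * ‖u‖) :
    ¬ closedBall (0 : E) r ⊆ convexHull ℝ S := by
  intro h
  have hconv : Convex ℝ {x : E | inner ℝ x u ≤ c} :=
    convex_halfSpace_le ⟨fun x y => inner_add_left x y u, fun a x => real_inner_smul_left x u a⟩ c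
  have hmem : (r * ‖u‖⁻¹) • u ∈ closedBall (0 : E) r := by
    rw [mem_closedBall_zero_iff, norm_smul, Real.norm_of_nonneg (by positivity), mul_assoc]
    exact mul_le_of_le_one_right hr inv_mul_le_one
  have hle : inner ℝ ((r * ‖u‖⁻¹) • u) u ≤ c := convexHull_min hS hconv (h hmem)
  rw [real_inner_smul_left, real_inner_self_eq_norm_sq] at hle
  rcases eq_or_ne ‖u‖ 0 with hu | hu
  · simp only [hu] at hle hc
    linarith
  · have : r * ‖u‖⁻¹ * ‖u‖ ^ 2 = r * ‖u‖ := by field_simp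
    linarith

/-- If each point `f k` is strictly cut off from the others by the functional `u k`, then any
subset of `range f` with fewer than `card ι` points lies in one of the half-spaces. -/
lemma exists_forall_inner_le_of_ncard_lt {E ι : Type*} [NormedAddCommGroup E]
    [InnerProductSpace ℝ E] [Fintype ι] {f u : ι → E} {c : ℝ}
    (hself : ∀ k, c < inner ℝ (f k) (u k))
    (hother : ∀ k l, l ≠ k → inner ℝ (f l) (u k) ≤ c)
    {S : Set E} (hS : S ⊆ Set.range f) (hcard : S.ncard < Fintype.card ι) :
    ∃ k, ∀ x ∈ S, inner ℝ x (u k) ≤ c := by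
  have hinj : Function.Injective f := by
    intro k l hkl
    by_contra hne
    exact absurd (hother k l (Ne.symm hne)) (not_le.2 (hkl ▸ hself k))
  obtain ⟨k, hk⟩ : ∃ k, f k ∉ S := by
    by_contra! h
    have hrange : S = Set.range f := hS.antisymm (Set.range_subset_iff.2 h)
    rw [hrange, ← Set.image_univ, Set.ncard_image_of_injective _ hinj, Set.ncard_univ,
      Nat.card_eq_fintype_card] at hcard
    exact lt_irrefl _ hcard
  refine ⟨k, fun x hx => ?_⟩
  obtain ⟨l, rfl⟩ := hS hx
  exact hother k l fun h => hk (h ▸ hx)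

namespace Grundbacher

/-- The sign attached to a Boolean. -/
def sign (b : Bool) : ℝ := if b then 1 else -1

/-- The points of the example: `none` is `√d·e_d`, `(last, b)` are `p₋` and `p₊`, and the other
indices give `±√d·eᵢ`. -/
noncomputable def point {d : ℕ} (last : Fin d) :
    Option (Fin d × Bool) → EuclideanSpace ℝ (Fin d)
  | none => √d • EuclideanSpace.single last 1
  | some (i, b) =>
    if i = last then
      (-√d) • (EuclideanSpace.single last 1 +
        sign b • ∑ j ∈ Finset.univ.erase last, EuclideanSpace.single j 1)
    else (√d * sign b) • EuclideanSpace.single i 1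

/-- The functional cutting off the corresponding point from all the others. -/
noncomputable def normal {d : ℕ} (last : Fin d) :
    Option (Fin d × Bool) → EuclideanSpace ℝ (Fin d)
  | none => ((d : ℝ) + 1) • EuclideanSpace.single last 1
  | some (i, b) => WithLp.toLp 2 fun j =>
    if i = last then if j = last then -d else -sign b
    else if j = last then 1 else if j = i then sign b * d else -sign b

variable {d : ℕ} (last : Fin d)

lemma sign_mul_self (b : Bool) : sign b * sign b = 1 := by
  cases b <;> simp [sign]

lemma neg_one_le_sign_mul (b c : Bool) : -1 ≤ sign b * sign c := by
  cases b <;> cases c <;> norm_num [sign]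

lemma sign_mul_of_ne {b c : Bool} (h : b ≠ c) : sign b * sign c = -1 := by
  cases b <;> cases c <;> simp_all [sign]

lemma inner_point_none (u : EuclideanSpace ℝ (Fin d)) :
    inner ℝ (point last none) u = √d * u last := by
  simp [point, real_inner_smul_left, EuclideanSpace.inner_single_left]

lemma inner_point_last (b : Bool) (u : EuclideanSpace ℝ (Fin d)) :
    inner ℝ (point last (some (last, b))) u =
      √d * -(u last + sign b * ∑ j ∈ Finset.univ.erase last, u j) := by
  simp only [point, if_true, real_inner_smul_left, inner_add_left, sum_inner,
    EuclideanSpace.inner_single_left, map_one, one_mul]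
  ring

lemma inner_point_of_ne {i : Fin d} (hi : i ≠ last) (b : Bool) (u : EuclideanSpace ℝ (Fin d)) :
    inner ℝ (point last (some (i, b))) u = √d * (sign b * u i) := by
  simp [point, hi, real_inner_smul_left, EuclideanSpace.inner_single_left, mul_assoc]

lemma sum_erase_normal_none : ∑ j ∈ Finset.univ.erase last, normal last none j = 0 :=
  Finset.sum_eq_zero fun j hj => by simp [normal, Finset.ne_of_mem_erase hj]

lemma card_erase_last : ((Finset.univ.erase last).card : ℝ) = d - 1 := by
  rw [Finset.card_erase_of_mem (Finset.mem_univ _), Finset.card_fin,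
    Nat.cast_sub (by have := last.pos; omega), Nat.cast_one]

lemma card_erase_erase_last {i : Fin d} (hi : i ≠ last) :
    (((Finset.univ.erase last).erase i).card : ℝ) = d - 2 := by
  have h := Finset.card_erase_add_one (Finset.mem_erase.2 ⟨hi, Finset.mem_univ i⟩)
  have h' := card_erase_last last
  rw [← h] at h'
  push_cast at h'
  linarith

lemma sum_erase_normal_last (b : Bool) :
    ∑ j ∈ Finset.univ.erase last, normal last (some (last, b)) j = (d - 1) * -sign b := by
  rw [← card_erase_last last, ← nsmul_eq_mul]
  exact Finset.sum_eq_card_nsmul fun j hj => by simp [normal, Finset.ne_of_mem_erase hj]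

lemma sum_erase_normal_of_ne {i : Fin d} (hi : i ≠ last) (b : Bool) :
    ∑ j ∈ Finset.univ.erase last, normal last (some (i, b)) j = 2 * sign b := by
  rw [← Finset.add_sum_erase _ _ (Finset.mem_erase.2 ⟨hi, Finset.mem_univ i⟩),
    Finset.sum_eq_card_nsmul (b := -sign b), nsmul_eq_mul, card_erase_erase_last last hi]
  · simp only [normal, hi, if_false, if_true]
    ring
  · intro j hj
    simp [normal, hi, Finset.ne_of_mem_erase hj,
      Finset.ne_of_mem_erase (Finset.mem_of_mem_erase hj)]

lemma le_norm_sq_normal (k : Option (Fin d × Bool)) :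
    (d : ℝ) ^ 2 + d - 1 ≤ ‖normal last k‖ ^ 2 := by
  rw [EuclideanSpace.real_norm_sq_eq, ← Finset.add_sum_erase _ _ (Finset.mem_univ last)]
  have hsq (b : Bool) : sign b ^ 2 = 1 := by rw [sq, sign_mul_self]
  rcases k with _ | ⟨i, b⟩
  · have h : 0 ≤ ∑ j ∈ Finset.univ.erase last, normal last none j ^ 2 :=
      Finset.sum_nonneg fun j _ => sq_nonneg _
    have h' : normal last none last = d + 1 := by simp [normal]
    rw [h']
    nlinarith [(Nat.cast_nonneg d : (0 : ℝ) ≤ d)]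
  · rcases eq_or_ne i last with rfl | hi
    · rw [Finset.sum_eq_card_nsmul (b := 1), nsmul_eq_mul, card_erase_last]
      · simp only [normal, if_true]
        linarith
      · intro j hj
        simp [normal, Finset.ne_of_mem_erase hj, hsq]
    · rw [← Finset.add_sum_erase _ _ (Finset.mem_erase.2 ⟨hi, Finset.mem_univ i⟩),
        Finset.sum_eq_card_nsmul (b := 1), nsmul_eq_mul, card_erase_erase_last last hi]
      · simp only [normal, hi, if_true, if_false, mul_pow, hsq]
        linarith
      · intro j hj
        simp [normal, hi, Finset.ne_of_mem_erase hj, hsq,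
          Finset.ne_of_mem_erase (Finset.mem_of_mem_erase hj)]

lemma sqrt_lt_inner_point_normal (hd : 2 ≤ d) (k : Option (Fin d × Bool)) :
    √d < inner ℝ (point last k) (normal last k) := by
  have hd' : (2 : ℝ) ≤ d := by exact_mod_cast hd
  have hpos : 0 < √(d : ℝ) := Real.sqrt_pos.2 (by linarith)
  rcases k with _ | ⟨i, b⟩
  · rw [inner_point_none]
    refine lt_mul_of_one_lt_right hpos ?_
    simp only [normal, PiLp.smul_apply, PiLp.single_apply, if_true, smul_eq_mul]
    linarith
  · rcases eq_or_ne i last with rfl | hi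
    · rw [inner_point_last, sum_erase_normal_last]
      refine lt_mul_of_one_lt_right hpos ?_
      simp only [normal, if_true]
      linear_combination 2 * hd' + (1 - (d : ℝ)) * sign_mul_self b
    · rw [inner_point_of_ne _ hi]
      refine lt_mul_of_one_lt_right hpos ?_
      simp only [normal, hi, if_true, if_false]
      linear_combination hd' - (d : ℝ) * sign_mul_self b

lemma inner_point_normal_le_sqrt (hd : 2 ≤ d) {k l : Option (Fin d × Bool)} (h : l ≠ k) :
    inner ℝ (point last l) (normal last k) ≤ √d := by
  have hd' : (2 : ℝ) ≤ d := by exact_mod_cast hd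
  have hpos : 0 ≤ √(d : ℝ) := Real.sqrt_nonneg _
  rcases l with _ | ⟨i, b⟩
  · rw [inner_point_none]
    refine mul_le_of_le_one_right hpos ?_
    rcases k with _ | ⟨j, c⟩
    · exact absurd rfl h
    · simp only [normal]
      split_ifs <;> linarith
  · rcases eq_or_ne i last with rfl | hi
    · rw [inner_point_last]
      refine mul_le_of_le_one_right hpos ?_
      rcases k with _ | ⟨j, c⟩
      · rw [sum_erase_normal_none]
        simp only [normal, PiLp.smul_apply, PiLp.single_apply, if_true, smul_eq_mul]
        linarith
      · rcases eq_or_ne j i with rfl | hj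
        · rw [sum_erase_normal_last]
          have hbc : b ≠ c := fun hbc => h (by rw [hbc])
          simp only [normal, if_true]
          linear_combination (d - 1 : ℝ) * sign_mul_of_ne hbc
        · rw [sum_erase_normal_of_ne _ hj]
          simp only [normal, hj, if_true, if_false]
          linarith [neg_one_le_sign_mul b c]
    · rw [inner_point_of_ne _ hi]
      refine mul_le_of_le_one_right hpos ?_
      rcases k with _ | ⟨j, c⟩
      · simp [normal, hi]
      · simp only [normal, hi, if_false]
        split_ifs with hj hij
        · linarith [neg_one_le_sign_mul b c]
        · subst hij
          have hbc : b ≠ c := fun hbc => h (by rw [hbc])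
          linear_combination (d : ℝ) * sign_mul_of_ne hbc + hd'
        · linarith [neg_one_le_sign_mul b c]

end Grundbacher

/-- **Grundbacher's example, part 2.** For `d ≥ 2`, consider
`Q = {±√d·e₁, …, ±√d·e_{d−1}, √d·e_d, p₋, p₊}` with
`p₋ = −√d(e_d + e₁ + ⋯ + e_{d−1})` and `p₊ = −√d(e_d − e₁ − ⋯ − e_{d−1})`.
Then for every `Q' ⊆ Q` of at most `2d` points and every `r > √(d/(d² + d − 1))`,
the ball `r·B^d` is not contained in `conv Q'`. -/
theorem grundbacher_example_optimality (d : ℕ) (hd : 2 ≤ d)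
    (e : Fin d → EuclideanSpace ℝ (Fin d))
    (he : ∀ i, e i = EuclideanSpace.single i 1)
    (last : Fin d) (hlast : (last : ℕ) = d - 1)
    (pminus pplus : EuclideanSpace ℝ (Fin d))
    (hpminus : pminus = (-(Real.sqrt d)) • (e last + ∑ i ∈ Finset.univ.erase last, e i))
    (hpplus : pplus = (-(Real.sqrt d)) • (e last - ∑ i ∈ Finset.univ.erase last, e i))
    (Q : Set (EuclideanSpace ℝ (Fin d)))
    (hQ : Q = (⋃ i ∈ {i : Fin d | i ≠ last},
        ({Real.sqrt d • e i, -(Real.sqrt d • e i)} : Set (EuclideanSpace ℝ (Fin d)))) ∪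
        {Real.sqrt d • e last, pminus, pplus}) :
    ∀ Q' ⊆ Q, Q'.ncard ≤ 2 * d →
      ∀ r : ℝ, r > Real.sqrt ((d : ℝ) / ((d : ℝ) ^ 2 + d - 1)) →
        ¬ (closedBall (0 : EuclideanSpace ℝ (Fin d)) r ⊆ convexHull ℝ Q') := by
  intro Q' hQ' hcard r hr
  have hd' : (2 : ℝ) ≤ d := by exact_mod_cast hd
  have hpos : (0 : ℝ) < (d : ℝ) ^ 2 + d - 1 := by nlinarith
  have hrange : Q ⊆ Set.range (Grundbacher.point last) := by
    obtain rfl : e = fun i => EuclideanSpace.single i 1 := funext he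
    rw [hQ]
    rintro x (hx | hx)
    · simp only [Set.mem_iUnion, Set.mem_ofPred_eq] at hx
      obtain ⟨i, hi, rfl | rfl⟩ := hx
      · exact ⟨some (i, true), by simp [Grundbacher.point, Grundbacher.sign, hi]⟩
      · exact ⟨some (i, false), by simp [Grundbacher.point, Grundbacher.sign, hi]⟩
    · obtain rfl | rfl | rfl := hx
      · exact ⟨none, rfl⟩
      · exact ⟨some (last, true), by simp [Grundbacher.point, Grundbacher.sign, hpminus]⟩
      · exact ⟨some (last, false), by
          simp [Grundbacher.point, Grundbacher.sign, hpplus, sub_eq_add_neg, add_comm]⟩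
  obtain ⟨k, hk⟩ := exists_forall_inner_le_of_ncard_lt
    (Grundbacher.sqrt_lt_inner_point_normal last hd)
    (fun _ _ => Grundbacher.inner_point_normal_le_sqrt last hd) (hQ'.trans hrange)
    (by simp; omega)
  refine not_closedBall_subset_convexHull_of_inner_le ((Real.sqrt_nonneg _).trans hr.le) hk ?_
  calc √(d : ℝ) = √((d : ℝ) / ((d : ℝ) ^ 2 + d - 1)) * √((d : ℝ) ^ 2 + d - 1) := by
        rw [← Real.sqrt_mul (by positivity), div_mul_cancel₀ _ hpos.ne']
    _ < r * √((d : ℝ) ^ 2 + d - 1) := mul_lt_mul_of_pos_right hr (Real.sqrt_pos.2 hpos)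
    _ ≤ r * ‖Grundbacher.normal last k‖ :=
        mul_le_mul_of_nonneg_left
          (Real.sqrt_le_iff.2 ⟨norm_nonneg _, Grundbacher.le_norm_sq_normal last k⟩)
          ((Real.sqrt_nonneg _).trans hr.le)
end

section
/- Let d ≥ 1 and let Q ⊂ ℝ^d be a set such that conv(Q) contains the closed Euclidean unit ball B^d. Then there exists a subset Q' ⊆ Q of at most 2d² points such that conv(Q') contains the ball (1/√d)·B^d. -/
open Metric

/-- If `x` is a subconvex combination of more than `finrank ℝ E` points, one of them can be
dropped. -/
lemma exists_erase_of_finrank_lt_card {E : Type*} [AddCommGroup E] [Module ℝ E]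
    [FiniteDimensional ℝ E] [DecidableEq E] {S : Finset E} (hS : Module.finrank ℝ E < S.card)
    {c : E → ℝ} (hc : ∀ q ∈ S, 0 ≤ c q) :
    ∃ p ∈ S, ∃ c' : E → ℝ, (∀ q ∈ S.erase p, 0 ≤ c' q) ∧
      ∑ q ∈ S.erase p, c' q ≤ ∑ q ∈ S, c q ∧
      ∑ q ∈ S.erase p, c' q • q = ∑ q ∈ S, c q • q := by
  obtain ⟨u, hu, hsum, hpos⟩ : ∃ u : E → ℝ, ∑ q ∈ S, u q • q = 0 ∧ 0 ≤ ∑ q ∈ S, u q ∧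
      ∃ q ∈ S, 0 < u q := by
    obtain ⟨f, hf, p, hp, hfp⟩ := Module.exists_nontrivial_relation_of_finrank_lt_card hS
    have key : ∀ g : E → ℝ, g p ≠ 0 → 0 ≤ ∑ q ∈ S, g q → ∃ q ∈ S, 0 < g q := by
      intro g hg hs
      by_contra! h
      exact hg ((Finset.sum_eq_zero_iff_of_nonpos h).1
        (le_antisymm (Finset.sum_nonpos h) hs) p hp)
    rcases le_total 0 (∑ q ∈ S, f q) with h | h
    · exact ⟨f, hf, h, key f hfp h⟩
    · have h' : 0 ≤ ∑ q ∈ S, (-f) q := by simpa using h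
      exact ⟨-f, by simp [hf], h', key (-f) (by simpa using hfp) h'⟩
  obtain ⟨p, hp, hmin⟩ := Finset.exists_min_image (S.filter (0 < u ·)) (fun q => c q / u q)
    (by simpa [Finset.Nonempty] using hpos)
  rw [Finset.mem_filter] at hp
  obtain ⟨hpS, hup⟩ := hp
  set s := c p / u p with hs
  have hs0 : 0 ≤ s := div_nonneg (hc p hpS) hup.le
  have hzero : c p - s * u p = 0 := by rw [hs]; field_simp; ring
  refine ⟨p, hpS, fun q => c q - s * u q, ?_, ?_, ?_⟩
  · intro q hq
    have hqS := Finset.mem_of_mem_erase hq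
    rcases lt_or_ge 0 (u q) with h | h
    · have := hmin q (by simp [hqS, h])
      rw [le_div_iff₀ h] at this
      linarith
    · have := hc q hqS
      nlinarith
  · rw [Finset.sum_erase (f := fun q => c q - s * u q) S hzero, Finset.sum_sub_distrib,
      ← Finset.mul_sum]
    nlinarith
  · rw [Finset.sum_erase (f := fun q => (c q - s * u q) • q) S (by simp [hzero])]
    simp only [sub_smul, mul_smul, Finset.sum_sub_distrib, ← Finset.smul_sum, hu, smul_zero,
      sub_zero]

/-- A subconvex combination can be rewritten using at most `finrank ℝ E` of the points. -/
lemma exists_subset_card_le_finrank {E : Type*} [AddCommGroup E] [Module ℝ E]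
    [FiniteDimensional ℝ E] (S : Finset E) (c : E → ℝ) (hc : ∀ q ∈ S, 0 ≤ c q) :
    ∃ T ⊆ S, T.card ≤ Module.finrank ℝ E ∧ ∃ c' : E → ℝ, (∀ q ∈ T, 0 ≤ c' q) ∧
      ∑ q ∈ T, c' q ≤ ∑ q ∈ S, c q ∧ ∑ q ∈ T, c' q • q = ∑ q ∈ S, c q • q := by
  classical
  induction S using Finset.strongInduction generalizing c with
  | H S ih =>
    rcases le_or_gt S.card (Module.finrank ℝ E) with h | h
    · exact ⟨S, subset_rfl, h, c, hc, le_rfl, rfl⟩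
    · obtain ⟨p, hp, c₁, hc₁, hle₁, heq₁⟩ := exists_erase_of_finrank_lt_card h hc
      obtain ⟨T, hT, hcard, c₂, hc₂, hle₂, heq₂⟩ := ih _ (Finset.erase_ssubset hp) c₁ hc₁
      exact ⟨T, hT.trans (Finset.erase_subset _ _), hcard, c₂, hc₂, hle₂.trans hle₁,
        heq₂.trans heq₁⟩

/-- A nonzero point of a convex hull can be pushed away from the origin until it lies in the convex
hull of at most `finrank ℝ E` of the points. -/
lemma exists_one_le_smul_mem_convexHull {E : Type*} [AddCommGroup E] [Module ℝ E]
    [FiniteDimensional ℝ E] {Q : Set E} {x : E} (hx : x ∈ convexHull ℝ Q) (hx0 : x ≠ 0) :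
    ∃ T : Finset E, (T : Set E) ⊆ Q ∧ T.card ≤ Module.finrank ℝ E ∧
      ∃ t : ℝ, 1 ≤ t ∧ t • x ∈ convexHull ℝ (T : Set E) := by
  rw [convexHull_eq_union_convexHull_finite_subsets] at hx
  simp only [Set.mem_iUnion] at hx
  obtain ⟨S, hSQ, hxS⟩ := hx
  rw [Finset.mem_convexHull'] at hxS
  obtain ⟨w, hw, hw1, rfl⟩ := hxS
  obtain ⟨T, hTS, hcard, c, hc, hle, heq⟩ := exists_subset_card_le_finrank S w hw
  have hpos : 0 < ∑ q ∈ T, c q := by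
    refine (Finset.sum_nonneg hc).lt_of_ne' fun h => hx0 ?_
    rw [← heq]
    refine Finset.sum_eq_zero fun q hq => ?_
    rw [(Finset.sum_eq_zero_iff_of_nonneg hc).1 h q hq, zero_smul]
  refine ⟨T, (Finset.coe_subset.2 hTS).trans hSQ, hcard, (∑ q ∈ T, c q)⁻¹,
    (one_le_inv₀ hpos).2 (hle.trans hw1.le), ?_⟩
  rw [← heq]
  exact Finset.centerMass_mem_convexHull T hc hpos fun q hq => hq

/-- A convex set containing the origin is closed under subconvex combinations. -/
lemma Convex.sum_mem_of_sum_le_one {E ι : Type*} [AddCommGroup E] [Module ℝ E] {K : Set E}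
    (hK : Convex ℝ K) (h0 : (0 : E) ∈ K) {s : Finset ι} {w : ι → ℝ} {z : ι → E}
    (hw : ∀ i ∈ s, 0 ≤ w i) (hw1 : ∑ i ∈ s, w i ≤ 1) (hz : ∀ i ∈ s, z i ∈ K) :
    ∑ i ∈ s, w i • z i ∈ K := by
  rcases (Finset.sum_nonneg hw).eq_or_lt' with h | h
  · rw [Finset.sum_eq_zero fun i hi => by
      rw [(Finset.sum_eq_zero_iff_of_nonneg hw).1 h i hi, zero_smul]]
    exact h0
  · have := hK.smul_mem_of_zero_mem h0 (hK.centerMass_mem hw h hz) ⟨h.le, hw1⟩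
    rwa [Finset.centerMass, smul_inv_smul₀ h.ne'] at this

/-- The sum of the absolute values of the coordinates is at most `√d` times the Euclidean norm. -/
lemma EuclideanSpace.sum_abs_le_sqrt_mul_norm {d : ℕ} (x : EuclideanSpace ℝ (Fin d)) :
    ∑ i, |x i| ≤ Real.sqrt d * ‖x‖ := by
  rw [EuclideanSpace.norm_eq, ← Real.sqrt_mul (Nat.cast_nonneg d)]
  refine Real.le_sqrt_of_sq_le ?_
  simpa using sq_sum_le_card_mul_sum_sq (s := Finset.univ) (f := fun i => |x i|)

/-- A convex set containing the vertices of the standard cross-polytope contains the ball of radius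
`1/√d`. -/
lemma closedBall_one_div_sqrt_subset {d : ℕ} {K : Set (EuclideanSpace ℝ (Fin d))}
    (hK : Convex ℝ K) (h0 : (0 : EuclideanSpace ℝ (Fin d)) ∈ K)
    (hpos : ∀ i, EuclideanSpace.single i (1 : ℝ) ∈ K)
    (hneg : ∀ i, -EuclideanSpace.single i (1 : ℝ) ∈ K) :
    closedBall (0 : EuclideanSpace ℝ (Fin d)) (1 / Real.sqrt d) ⊆ K := by
  intro x hx
  rw [mem_closedBall_zero_iff] at hx
  have hsum : ∑ i, |x i| ≤ 1 := by
    refine (EuclideanSpace.sum_abs_le_sqrt_mul_norm x).trans ?_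
    refine (mul_le_mul_of_nonneg_left hx (Real.sqrt_nonneg _)).trans ?_
    rw [mul_one_div]
    exact div_self_le_one _
  have hrepr : x = ∑ i, |x i| • (if 0 ≤ x i then EuclideanSpace.single i (1 : ℝ)
      else -EuclideanSpace.single i (1 : ℝ)) := by
    conv_lhs => rw [← (EuclideanSpace.basisFun (Fin d) ℝ).sum_repr x]
    refine Finset.sum_congr rfl fun i _ => ?_
    split_ifs with h
    · simp [abs_of_nonneg h]
    · simp [abs_of_neg (not_le.1 h)]
  rw [hrepr]
  refine hK.sum_mem_of_sum_le_one h0 (fun i _ => abs_nonneg _) hsum fun i _ => ?_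
  split_ifs
  exacts [hpos i, hneg i]

/-- If the convex hull of a set `Q ⊆ ℝ^d` contains the closed unit ball, then there is a
subset `Q' ⊆ Q` of at most `2d²` points whose convex hull contains the ball `(1/√d)·B^d`. -/
theorem reduction_to_quadratically_many_points (d : ℕ) (hd : 1 ≤ d)
    (Q : Set (EuclideanSpace ℝ (Fin d)))
    (hQ : closedBall (0 : EuclideanSpace ℝ (Fin d)) 1 ⊆ convexHull ℝ Q) :
    ∃ Q' : Finset (EuclideanSpace ℝ (Fin d)),
      (Q' : Set (EuclideanSpace ℝ (Fin d))) ⊆ Q ∧ Q'.card ≤ 2 * d ^ 2 ∧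
      closedBall (0 : EuclideanSpace ℝ (Fin d)) (1 / Real.sqrt d) ⊆
        convexHull ℝ (Q' : Set (EuclideanSpace ℝ (Fin d))) := by
  classical
  have hvertex : ∀ x : EuclideanSpace ℝ (Fin d),
      ‖x‖ = 1 → ∃ T : Finset (EuclideanSpace ℝ (Fin d)),
        (T : Set (EuclideanSpace ℝ (Fin d))) ⊆ Q ∧ T.card ≤ d ∧
        ∃ t : ℝ, 1 ≤ t ∧ t • x ∈ convexHull ℝ (T : Set (EuclideanSpace ℝ (Fin d))) := by
    intro x hx
    simpa using exists_one_le_smul_mem_convexHull (hQ (by simp [hx]))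
      (norm_ne_zero_iff.1 (hx ▸ one_ne_zero))
  choose A hAQ hAcard a ha hamem using fun i : Fin d =>
    hvertex (EuclideanSpace.single i (1 : ℝ)) (by simp)
  choose B hBQ hBcard b hb hbmem using fun i : Fin d =>
    hvertex (-EuclideanSpace.single i (1 : ℝ)) (by simp)
  set Q' := Finset.univ.biUnion fun i => A i ∪ B i
  have hsub : ∀ i, A i ∪ B i ⊆ Q' := fun i =>
    Finset.subset_biUnion_of_mem (fun i => A i ∪ B i) (Finset.mem_univ i)
  have hK := convex_convexHull ℝ (Q' : Set (EuclideanSpace ℝ (Fin d)))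
  have hA : ∀ i, a i • EuclideanSpace.single i (1 : ℝ) ∈ convexHull ℝ (Q' : Set _) := fun i =>
    convexHull_mono (Finset.coe_subset.2 (Finset.subset_union_left.trans (hsub i))) (hamem i)
  have hB : ∀ i, b i • -EuclideanSpace.single i (1 : ℝ) ∈ convexHull ℝ (Q' : Set _) := fun i =>
    convexHull_mono (Finset.coe_subset.2 (Finset.subset_union_right.trans (hsub i))) (hbmem i)
  have h0 : (0 : EuclideanSpace ℝ (Fin d)) ∈ convexHull ℝ (Q' : Set _) := by
    let i : Fin d := ⟨0, hd⟩
    have ha0 : 0 < a i := one_pos.trans_le (ha i)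
    have hb0 : 0 < b i := one_pos.trans_le (hb i)
    have hab := add_pos ha0 hb0
    have := hK (hA i) (hB i) (div_pos hb0 hab).le (div_pos ha0 hab).le
      (by rw [← add_div, add_comm, div_self hab.ne'])
    convert this using 1
    rw [smul_neg, smul_neg, smul_smul, smul_smul, ← sub_eq_add_neg, ← sub_smul]
    rw [div_mul_eq_mul_div, div_mul_eq_mul_div, mul_comm, sub_self, zero_smul]
  have hshrink : ∀ (t : ℝ) (x : EuclideanSpace ℝ (Fin d)), 1 ≤ t →
      t • x ∈ convexHull ℝ (Q' : Set _) → x ∈ convexHull ℝ (Q' : Set _) := by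
    intro t x ht hx
    have ht0 : 0 < t := one_pos.trans_le ht
    simpa [smul_smul, ht0.ne'] using
      hK.smul_mem_of_zero_mem h0 hx ⟨(inv_pos.2 ht0).le, inv_le_one_of_one_le₀ ht⟩
  refine ⟨Q', ?_, ?_, closedBall_one_div_sqrt_subset hK h0
    (fun i => hshrink _ _ (ha i) (hA i)) (fun i => hshrink _ _ (hb i) (hB i))⟩
  · simpa [Q'] using fun i => ⟨hAQ i, hBQ i⟩
  · calc Q'.card ≤ (Finset.univ : Finset (Fin d)).card * (d + d) :=
          Finset.card_biUnion_le_card_mul _ _ _ fun i _ =>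
            (Finset.card_union_le _ _).trans (add_le_add (hAcard i) (hBcard i))
      _ = 2 * d ^ 2 := by rw [Finset.card_univ, Fintype.card_fin]; ring
end
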